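/- Let d ≥ 2, x₀ ∈ ℝ^d, r₀ > 0, Ω = B(x₀, 3r₀), and let W : Ω → ℝ be measurable with W_∞ := ‖W‖_∞ < ∞. There exists a constant C̃ ≥ 1, depending only on d and r₀²W_∞, with the following property. For every N ∈ ℕ₀ there is a linear map Y_N from E_N(Ω) to the space of homogeneous harmonic polynomials of degree N in d real variables such that for every φ ∈ E_N(Ω) and every x with |x−x₀| ≤ r₀/2: |φ(x) − (Y_N φ)(x−x₀)| ≤ r₀^{−d/2} (r₀^{−1} C̃)^{N+1} (16/3)^{(N+1)(N+2)/2} ((N+1)!)^{d−2} · |x−x₀|^{N+1} · ‖φ‖_{L²(Ω)}. Moreover, the kernel of Y_N equals E_{N+1}(Ω). -/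

import Mathlib

open MeasureTheory

/-- The Laplacian `Δf = ∑ j ∂²f/∂x_j²` of a function on `ℝ^d`. -/
noncomputable def lap {d : ℕ} (f : EuclideanSpace ℝ (Fin d) → ℝ)
    (x : EuclideanSpace ℝ (Fin d)) : ℝ :=
  ∑ i, fderiv ℝ (fun y => fderiv ℝ f y (EuclideanSpace.single i 1)) x
    (EuclideanSpace.single i 1)

/-- The space `H_N^{(d)}` of homogeneous harmonic polynomials of degree `N`
in `d` real variables. -/
noncomputable def harmHomog (d N : ℕ) : Submodule ℝ (MvPolynomial (Fin d) ℝ) :=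
  MvPolynomial.homogeneousSubmodule (Fin d) ℝ N ⊓
    LinearMap.ker (∑ j : Fin d,
      ((MvPolynomial.pderiv j).toLinearMap ∘ₗ (MvPolynomial.pderiv j).toLinearMap))

/-- `E₀(Ω)`: real-valued, twice continuously differentiable, square-integrable solutions
of `Δφ = Wφ` a.e. on `Ω`. -/
def solSet {d : ℕ} (Ω : Set (EuclideanSpace ℝ (Fin d)))
    (W : EuclideanSpace ℝ (Fin d) → ℝ) : Set (EuclideanSpace ℝ (Fin d) → ℝ) :=
  {φ | ContDiffOn ℝ 2 φ Ω ∧ IntegrableOn (fun x => φ x ^ 2) Ω ∧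
    ∀ᵐ x ∂volume, x ∈ Ω → lap φ x = W x * φ x}

/-- `E_N(Ω)`: solutions with `limsup_{x→x₀} |φ(x)|/|x-x₀|^N < ∞`, i.e. with
`|φ(x)| ≤ M |x-x₀|^N` near (but off) `x₀` for some `M`. -/
def solSetN {d : ℕ} (Ω : Set (EuclideanSpace ℝ (Fin d)))
    (W : EuclideanSpace ℝ (Fin d) → ℝ) (x₀ : EuclideanSpace ℝ (Fin d)) (N : ℕ) :
    Set (EuclideanSpace ℝ (Fin d) → ℝ) :=
  {φ ∈ solSet Ω W |
    ∃ M : ℝ, ∀ᶠ x in nhdsWithin x₀ {x₀}ᶜ, |φ x| ≤ M * ‖x - x₀‖ ^ N}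

section

open Filter Topology

/-- The second derivative of `f` in the direction `v`. -/
noncomputable def secondDirDeriv {E : Type*} [NormedAddCommGroup E] [NormedSpace ℝ E]
    (v : E) (f : E → ℝ) (x : E) : ℝ :=
  fderiv ℝ (fun y => fderiv ℝ f y v) x v

/-- The Laplacian on `EuclideanSpace ℝ ι` for an arbitrary finite index type. -/
noncomputable def eLap {ι : Type*} [Fintype ι] [DecidableEq ι]
    (f : EuclideanSpace ℝ ι → ℝ) (x : EuclideanSpace ℝ ι) : ℝ :=
  ∑ i, secondDirDeriv (EuclideanSpace.single i 1) f x

section SecondDirDeriv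

variable {E : Type*} [NormedAddCommGroup E] [NormedSpace ℝ E]

lemma ContDiffAt.contDiffAt_fderiv_apply_const {f : E → ℝ} {x : E} (hf : ContDiffAt ℝ 2 f x)
    (v : E) : ContDiffAt ℝ 1 (fun y => fderiv ℝ f y v) x :=
  (hf.fderiv_right (m := 1) (by norm_num)).clm_apply contDiffAt_const

lemma ContDiff.contDiff_fderiv_apply_const {f : E → ℝ} (hf : ContDiff ℝ 2 f)
    (v : E) : ContDiff ℝ 1 (fun y => fderiv ℝ f y v) :=
  contDiff_iff_contDiffAt.2 fun _ => hf.contDiffAt.contDiffAt_fderiv_apply_const v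

lemma continuousAt_secondDirDeriv {f : E → ℝ} {x : E} (hf : ContDiffAt ℝ 2 f x) (v : E) :
    ContinuousAt (secondDirDeriv v f) x :=
  (((hf.contDiffAt_fderiv_apply_const v).fderiv_right (m := 0) (by norm_num)).clm_apply
    contDiffAt_const).continuousAt

lemma Filter.EventuallyEq.secondDirDeriv_eq {f g : E → ℝ} {x : E} (h : f =ᶠ[nhds x] g) (v : E) :
    secondDirDeriv v f x = secondDirDeriv v g x := by
  have h' : (fun y => fderiv ℝ f y v) =ᶠ[nhds x] (fun y => fderiv ℝ g y v) := by
    filter_upwards [h.eventuallyEq_nhds] with y hy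
    rw [hy.fderiv_eq]
  rw [secondDirDeriv, h'.fderiv_eq, secondDirDeriv]

lemma secondDirDeriv_mul {f g : E → ℝ} (hf : ContDiff ℝ 2 f) (hg : ContDiff ℝ 2 g) (v x : E) :
    secondDirDeriv v (fun y => f y * g y) x =
      f x * secondDirDeriv v g x + 2 * (fderiv ℝ f x v * fderiv ℝ g x v) +
        g x * secondDirDeriv v f x := by
  have h1 : (fun y => fderiv ℝ (fun y => f y * g y) y v) =
      fun y => f y * fderiv ℝ g y v + g y * fderiv ℝ f y v := by
    funext y
    rw [fderiv_fun_mul (hf.differentiable (by norm_num) y) (hg.differentiable (by norm_num) y)]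
    simp
  have hf1 := (hf.contDiff_fderiv_apply_const v).differentiable (by norm_num) x
  have hg1 := (hg.contDiff_fderiv_apply_const v).differentiable (by norm_num) x
  have hf0 := hf.differentiable (by norm_num) x
  have hg0 := hg.differentiable (by norm_num) x
  simp only [secondDirDeriv]
  rw [h1, fderiv_fun_add (hf0.fun_mul hg1) (hg0.fun_mul hf1), fderiv_fun_mul hf0 hg1, fderiv_fun_mul hg0 hf1]
  simp
  ring

lemma secondDirDeriv_comp_affine {F : Type*} [NormedAddCommGroup F] [NormedSpace ℝ F]
    {f : E → ℝ} (L : F →L[ℝ] E) (a : E) {x : F}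
    (hf : ContDiffAt ℝ 2 f (a + L x)) (v : F) :
    secondDirDeriv v (fun y => f (a + L y)) x = secondDirDeriv (L v) f (a + L x) := by
  have hcont : ContinuousAt (fun y => a + L y) x := by fun_prop
  have h2 : ∀ᶠ z in nhds (a + L x), ContDiffAt ℝ 2 f z := hf.eventually (by simp)
  have hL : ∀ y, HasFDerivAt (fun y => a + L y) L y := fun y => by
    simpa using (L.hasFDerivAt (x := y)).const_add a
  have h1 : (fun y => fderiv ℝ (fun y => f (a + L y)) y v) =ᶠ[nhds x]
      fun y => fderiv ℝ f (a + L y) (L v) := by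
    filter_upwards [hcont.eventually h2] with y hy
    have := (hy.differentiableAt (by norm_num)).hasFDerivAt.comp y (hL y)
    rw [HasFDerivAt.fderiv (f := fun y => f (a + L y)) this]
    simp
  rw [secondDirDeriv, h1.fderiv_eq]
  have h3 := ((hf.contDiffAt_fderiv_apply_const (L v)).differentiableAt
    (by norm_num)).hasFDerivAt.comp x (hL x)
  rw [HasFDerivAt.fderiv (f := fun y => fderiv ℝ f (a + L y) (L v)) h3]
  simp [secondDirDeriv]

lemma secondDirDeriv_zero (f : E → ℝ) (x : E) : secondDirDeriv 0 f x = 0 := by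
  simp [secondDirDeriv]

lemma HasCompactSupport.fderiv_apply_const {f : E → ℝ} (hf : HasCompactSupport f) (v : E) :
    HasCompactSupport (fun y => fderiv ℝ f y v) := 
  hf.fderiv_apply ℝ v

variable [FiniteDimensional ℝ E] [MeasurableSpace E] [BorelSpace E]

lemma integral_mul_secondDirDeriv_comm {μ : Measure E} [μ.IsAddHaarMeasure] {u η : E → ℝ}
    (hu : ContDiff ℝ 2 u) (hη : ContDiff ℝ 2 η) (hc : HasCompactSupport η) (v : E) :
    ∫ y, u y * secondDirDeriv v η y ∂μ = ∫ y, η y * secondDirDeriv v u y ∂μ := by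
  have hu1 := hu.contDiff_fderiv_apply_const v
  have hη1 := hη.contDiff_fderiv_apply_const v
  have hc1 := hc.fderiv_apply_const v
  have hc2 := hc1.fderiv_apply_const v
  have cu2 : Continuous (fun y => fderiv ℝ (fun y => fderiv ℝ u y v) y v) :=
    continuous_iff_continuousAt.2 fun y => continuousAt_secondDirDeriv hu.contDiffAt v
  have cη2 : Continuous (fun y => fderiv ℝ (fun y => fderiv ℝ η y v) y v) :=
    continuous_iff_continuousAt.2 fun y => continuousAt_secondDirDeriv hη.contDiffAt v
  have e1 := integral_mul_fderiv_eq_neg_fderiv_mul_of_integrable (μ := μ) (v := v)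
    (f := u) (g := fun y => fderiv ℝ η y v)
    ((hu1.continuous.mul hη1.continuous).integrable_of_hasCompactSupport (hc1.mul_left))
    ((hu.continuous.mul cη2).integrable_of_hasCompactSupport (hc2.mul_left))
    ((hu.continuous.mul hη1.continuous).integrable_of_hasCompactSupport (hc1.mul_left))
    (fun y _ => hu.differentiable (by norm_num) y)
    (fun y _ => hη1.differentiable (by norm_num) y)
  have e2 := integral_mul_fderiv_eq_neg_fderiv_mul_of_integrable (μ := μ) (v := v)
    (f := η) (g := fun y => fderiv ℝ u y v)
    ((hη1.continuous.mul hu1.continuous).integrable_of_hasCompactSupport (hc1.mul_right))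
    ((hη.continuous.mul cu2).integrable_of_hasCompactSupport (hc.mul_right))
    ((hη.continuous.mul hu1.continuous).integrable_of_hasCompactSupport (hc.mul_right))
    (fun y _ => hη.differentiable (by norm_num) y)
    (fun y _ => hu1.differentiable (by norm_num) y)
  simp only [secondDirDeriv]
  rw [e1, e2]
  congr 1
  exact integral_congr_ae (Filter.Eventually.of_forall fun y => mul_comm _ _)

end SecondDirDeriv

section ELap

variable {ι : Type*} [Fintype ι] [DecidableEq ι]

lemma continuousAt_eLap {f : EuclideanSpace ℝ ι → ℝ} {x : EuclideanSpace ℝ ι}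
    (hf : ContDiffAt ℝ 2 f x) : ContinuousAt (eLap f) x :=
  tendsto_finsetSum _ fun _ _ => continuousAt_secondDirDeriv hf _

lemma continuous_eLap {f : EuclideanSpace ℝ ι → ℝ} (hf : ContDiff ℝ 2 f) : Continuous (eLap f) :=
  continuous_iff_continuousAt.2 fun _ => continuousAt_eLap hf.contDiffAt

lemma Filter.EventuallyEq.eLap_eq {f g : EuclideanSpace ℝ ι → ℝ} {x : EuclideanSpace ℝ ι}
    (h : f =ᶠ[nhds x] g) : eLap f x = eLap g x :=
  Finset.sum_congr rfl fun _ _ => h.secondDirDeriv_eq _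

lemma eLap_mul {f g : EuclideanSpace ℝ ι → ℝ} (hf : ContDiff ℝ 2 f) (hg : ContDiff ℝ 2 g)
    (x : EuclideanSpace ℝ ι) :
    eLap (fun y => f y * g y) x = f x * eLap g x +
      2 * ∑ i, fderiv ℝ f x (EuclideanSpace.single i 1) * fderiv ℝ g x (EuclideanSpace.single i 1) +
      g x * eLap f x := by
  simp only [eLap, secondDirDeriv_mul hf hg, Finset.sum_add_distrib, Finset.mul_sum]

lemma eLap_comp_homothety {f : EuclideanSpace ℝ ι → ℝ} (a : EuclideanSpace ℝ ι) (r : ℝ)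
    {x : EuclideanSpace ℝ ι} (hf : ContDiffAt ℝ 2 f (a + r • x)) :
    eLap (fun y => f (a + r • y)) x = r ^ 2 * eLap f (a + r • x) := by
  simp only [eLap, Finset.mul_sum]
  refine Finset.sum_congr rfl fun i _ => ?_
  have := secondDirDeriv_comp_affine (r • ContinuousLinearMap.id ℝ (EuclideanSpace ℝ ι)) a
    (x := x) hf (EuclideanSpace.single i 1)
  simp only [smul_apply, ContinuousLinearMap.id_apply] at this
  rw [this]
  simp only [secondDirDeriv, map_smul, smul_eq_mul]
  have h2 : (fun y => r * fderiv ℝ f y (EuclideanSpace.single i 1)) =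
      r • fun y => fderiv ℝ f y (EuclideanSpace.single i 1) := rfl
  rw [h2, fderiv_const_smul (hf.contDiffAt_fderiv_apply_const _ |>.differentiableAt (by norm_num))]
  simp
  ring

lemma integral_mul_eLap_comm {u η : EuclideanSpace ℝ ι → ℝ}
    (hu : ContDiff ℝ 2 u) (hη : ContDiff ℝ 2 η) (hc : HasCompactSupport η) :
    ∫ y, u y * eLap η y = ∫ y, η y * eLap u y := by
  have cont : ∀ {f : EuclideanSpace ℝ ι → ℝ}, ContDiff ℝ 2 f → ∀ v,
      Continuous (secondDirDeriv v f) := fun hf v =>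
    continuous_iff_continuousAt.2 fun y => continuousAt_secondDirDeriv hf.contDiffAt v
  simp only [eLap, Finset.mul_sum]
  rw [integral_finsetSum, integral_finsetSum]
  · exact Finset.sum_congr rfl fun i _ => integral_mul_secondDirDeriv_comm hu hη hc _
  · exact fun i _ => (hη.continuous.mul (cont hu _)).integrable_of_hasCompactSupport hc.mul_right
  · exact fun i _ => (hu.continuous.mul (cont hη _)).integrable_of_hasCompactSupport
      ((hc.fderiv_apply_const _).fderiv_apply_const _).mul_left

end ELap

/-- The regularised kernel `z ↦ (‖z‖² + e)^{-m}`. -/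
noncomputable def regKernel {E : Type*} [NormedAddCommGroup E] (m : ℕ) (e : ℝ) (z : E) : ℝ :=
  ((‖z‖ ^ 2 + e) ^ m)⁻¹

section RegKernel

variable {E : Type*} [NormedAddCommGroup E]

lemma regKernel_nonneg (m : ℕ) {e : ℝ} (he : 0 ≤ e) (z : E) : 0 ≤ regKernel m e z := by
  unfold regKernel; positivity

lemma regKernel_zero_eq (m : ℕ) (z : E) : regKernel m 0 z = (‖z‖ ^ (2 * m))⁻¹ := by
  simp [regKernel, pow_mul]

lemma regKernel_le (m : ℕ) {e : ℝ} (he : 0 ≤ e) {z : E} (hz : z ≠ 0) :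
    regKernel m e z ≤ regKernel m 0 z := by
  unfold regKernel
  have : 0 < ‖z‖ := norm_pos_iff.2 hz
  gcongr

lemma measurable_regKernel [MeasurableSpace E] [BorelSpace E] (m : ℕ) (e : ℝ) :
    Measurable (regKernel m e : E → ℝ) :=
  (((measurable_norm.pow_const 2).add_const e).pow_const m).inv

variable [InnerProductSpace ℝ E]

lemma contDiff_regKernel_sub (m : ℕ) {e : ℝ} (he : 0 < e) (x : E) {n : WithTop ℕ∞} :
    ContDiff ℝ n fun y => regKernel m e (x - y) := by
  unfold regKernel
  refine ContDiff.inv ?_ fun y => by positivity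
  exact (((contDiff_norm_sq ℝ).comp (contDiff_const.sub contDiff_id)).add contDiff_const).pow m

lemma fderiv_regKernel_sub (m : ℕ) {e : ℝ} (he : 0 < e) (x y v : E) :
    fderiv ℝ (fun y => regKernel m e (x - y)) y v =
      2 * m * inner ℝ (x - y) v * regKernel (m + 1) e (x - y) := by
  have h0 : HasFDerivAt (fun y => x - y) (-ContinuousLinearMap.id ℝ E) y := by
    simpa using (hasFDerivAt_id y).const_sub x
  have h1 : HasFDerivAt (fun y => ‖x - y‖ ^ 2 + e) _ y := (h0.norm_sq).add_const e
  have hpos : 0 < ‖x - y‖ ^ 2 + e := by positivity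
  have h2 := (hasDerivAt_inv (pow_pos hpos m).ne').comp_hasFDerivAt y (h1.pow m)
  rw [HasFDerivAt.fderiv (f := fun y => regKernel m e (x - y)) h2]
  rcases m with _ | m
  · simp
  · simp [regKernel, inner_sub_left]
    field_simp
    ring

lemma secondDirDeriv_regKernel_sub (m : ℕ) {e : ℝ} (he : 0 < e) (x y v : E) :
    secondDirDeriv v (fun y => regKernel m e (x - y)) y =
      -(2 * m * ‖v‖ ^ 2) * regKernel (m + 1) e (x - y) +
        4 * m * (m + 1) * inner ℝ (x - y) v ^ 2 * regKernel (m + 2) e (x - y) := by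
  simp only [secondDirDeriv, fderiv_regKernel_sub m he]
  have h0 : HasFDerivAt (fun y => x - y) (-ContinuousLinearMap.id ℝ E) y := by
    simpa using (hasFDerivAt_id y).const_sub x
  have h1 : HasFDerivAt (fun y => (2 * m : ℝ) * inner ℝ (x - y) v) _ y :=
    (h0.inner ℝ (hasFDerivAt_const v y)).const_mul (2 * m : ℝ)
  have h2 := ((contDiff_regKernel_sub (m + 1) he x (n := 1)).differentiable (by norm_num)
    y).hasFDerivAt
  rw [HasFDerivAt.fderiv (h1.fun_mul h2)]
  simp only [add_apply, smul_apply, fderiv_regKernel_sub (m + 1) he, smul_eq_mul]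
  simp [inner_sub_left]
  ring

end RegKernel

lemma eLap_regKernel_sub {ι : Type*} [Fintype ι] [DecidableEq ι] {m : ℕ}
    (hm : Fintype.card ι = 2 * m + 2) {e : ℝ} (he : 0 < e) (x y : EuclideanSpace ℝ ι) :
    eLap (fun y => regKernel m e (x - y)) y =
      -(4 * m * (m + 1) * (e * regKernel (m + 2) e (x - y))) := by
  have hsum : ∑ i, inner ℝ (x - y) (EuclideanSpace.single i (1 : ℝ)) ^ 2 = ‖x - y‖ ^ 2 := by
    simp [EuclideanSpace.norm_sq_eq, EuclideanSpace.inner_single_right]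
  simp only [eLap, secondDirDeriv_regKernel_sub m he, Finset.sum_add_distrib, ← Finset.sum_mul,
    ← Finset.mul_sum, hsum]
  have hpos : 0 < ‖x - y‖ ^ 2 + e := by positivity
  simp [regKernel, hm]
  field_simp
  ring

lemma integrableOn_norm_pow_inv {E : Type*} [NormedAddCommGroup E] [NormedSpace ℝ E]
    [FiniteDimensional ℝ E] [MeasurableSpace E] [BorelSpace E] (μ : Measure E)
    [μ.IsAddHaarMeasure] {p : ℕ} (hp : p < Module.finrank ℝ E) (R : ℝ) :
    IntegrableOn (fun z : E => (‖z‖ ^ p)⁻¹) (Metric.ball 0 R) μ := by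
  have : Nontrivial E := Module.nontrivial_of_finrank_pos (R := ℝ) (by omega)
  rw [integrableOn_fun_norm_addHaar μ (f := fun t => (t ^ p)⁻¹)]
  have : ContinuousOn (fun t : ℝ => t ^ (Module.finrank ℝ E - 1 - p)) (Set.Icc 0 R) := by fun_prop
  refine (this.integrableOn_Icc.mono_set Set.Ioo_subset_Icc_self).congr_fun (fun t ht => ?_) measurableSet_Ioo
  have ht0 : t ≠ 0 := ht.1.ne'
  have : Module.finrank ℝ E - 1 = (Module.finrank ℝ E - 1 - p) + p := by omega
  simp only [smul_eq_mul]
  conv_rhs => rw [this, pow_add]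
  field_simp

lemma integrable_regKernel_one {E : Type*} [NormedAddCommGroup E] [NormedSpace ℝ E]
    [FiniteDimensional ℝ E] [MeasurableSpace E] [BorelSpace E] (μ : Measure E)
    [μ.IsAddHaarMeasure] {p : ℕ} (hp : Module.finrank ℝ E < 2 * p) :
    Integrable (regKernel p 1 : E → ℝ) μ := by
  have := integrable_rpow_neg_one_add_norm_sq (E := E) (μ := μ) (r := 2 * p) (by exact_mod_cast hp)
  refine this.congr (Filter.Eventually.of_forall fun z => ?_)
  have h : (0 : ℝ) ≤ 1 + ‖z‖ ^ 2 := by positivity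
  simp only [regKernel]
  rw [show (-(2 * (p : ℝ)) / 2) = -(p : ℝ) by ring, Real.rpow_neg h, Real.rpow_natCast, add_comm]

/-- The kernel `2 ∇χ(y) · ∇_y k(x - y) + k(x - y) Δχ(y)` where `k = regKernel m e`. -/
noncomputable def cutoffKernel {ι : Type*} [Fintype ι] [DecidableEq ι] (m : ℕ) (e : ℝ)
    (χ : EuclideanSpace ℝ ι → ℝ) (x y : EuclideanSpace ℝ ι) : ℝ :=
  4 * m * fderiv ℝ χ y (x - y) * regKernel (m + 1) e (x - y) + regKernel m e (x - y) * eLap χ y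

/-- The normalising constant in the representation formula. -/
noncomputable def kernelConst (ι : Type*) [Fintype ι] (m : ℕ) : ℝ :=
  4 * m * (m + 1) * ∫ w : EuclideanSpace ℝ ι, regKernel (m + 2) 1 w

section Representation

variable {ι : Type*} [Fintype ι]

lemma integrable_regKernel_ball {m : ℕ} (hm : 2 * m < Fintype.card ι) (R : ℝ) :
    IntegrableOn (regKernel m 0 : EuclideanSpace ℝ ι → ℝ) (Metric.ball 0 R) := by
  have := integrableOn_norm_pow_inv (E := EuclideanSpace ℝ ι) volume (p := 2 * m) (by simpa using hm) R
  exact this.congr_fun (fun z _ => (regKernel_zero_eq m z).symm) measurableSet_ball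

lemma integrable_mul_regKernel_sub {m : ℕ} (hm : 2 * m < Fintype.card ι)
    {g : EuclideanSpace ℝ ι → ℝ} (hg : Continuous g) (hc : HasCompactSupport g)
    (x : EuclideanSpace ℝ ι) : Integrable fun y => g y * regKernel m 0 (x - y) := by
  obtain ⟨C, hC⟩ := hg.bounded_above_of_compact_support hc
  obtain ⟨R, hR⟩ := hc.isCompact.isBounded.subset_ball x
  have h1 : Integrable ((Metric.ball (0 : EuclideanSpace ℝ ι) R).indicator (regKernel m 0)) :=
    (integrable_regKernel_ball hm R).integrable_indicator measurableSet_ball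
  have h2 := h1.comp_sub_left x
  refine (h2.bdd_mul (c := C) hg.aestronglyMeasurable (Eventually.of_forall hC)).congr
    (Eventually.of_forall fun y => ?_)
  by_cases hy : g y = 0
  · simp [hy]
  · have : x - y ∈ Metric.ball (0 : EuclideanSpace ℝ ι) R := by
      have := hR (subset_tsupport g hy)
      simpa [dist_eq_norm, norm_sub_rev] using this
    simp [Set.indicator_of_mem this]

lemma tendsto_regKernel {m : ℕ} {z : EuclideanSpace ℝ ι} (hz : z ≠ 0) :
    Tendsto (fun ε : ℝ => regKernel m (ε ^ 2) z) (𝓝[>] 0) (𝓝 (regKernel m 0 z)) := by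
  have : 0 < ‖z‖ := norm_pos_iff.2 hz
  have hcont : ContinuousAt (fun ε : ℝ => regKernel m (ε ^ 2) z) 0 := by
    unfold regKernel
    refine ContinuousAt.inv₀ (by fun_prop) (by positivity)
  simpa using hcont.tendsto.mono_left nhdsWithin_le_nhds

lemma tendsto_integral_mul_regKernel [Nonempty ι] {m : ℕ} (hm : 2 * m < Fintype.card ι)
    {g : EuclideanSpace ℝ ι → ℝ} (hg : Continuous g) (hc : HasCompactSupport g)
    (x : EuclideanSpace ℝ ι) :
    Tendsto (fun ε : ℝ => ∫ y, g y * regKernel m (ε ^ 2) (x - y)) (𝓝[>] 0)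
      (𝓝 (∫ y, g y * regKernel m 0 (x - y))) := by
  have hne : ∀ᵐ y : EuclideanSpace ℝ ι, y ≠ x := by
    simp [ae_iff]
  refine tendsto_integral_filter_of_dominated_convergence
    (fun y => ‖g y * regKernel m 0 (x - y)‖) (Eventually.of_forall fun ε => ?_)
    (Eventually.of_forall fun ε => ?_) (integrable_mul_regKernel_sub hm hg hc x).norm ?_
  · exact (hg.measurable.mul ((measurable_regKernel m _).comp (measurable_const.sub
      measurable_id))).aestronglyMeasurable
  · filter_upwards [hne] with y hy
    rw [norm_mul, norm_mul, Real.norm_of_nonneg (regKernel_nonneg _ (sq_nonneg _) _),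
      Real.norm_of_nonneg (regKernel_nonneg _ le_rfl _)]
    gcongr
    exact regKernel_le m (sq_nonneg _) (sub_ne_zero.2 hy.symm)
  · filter_upwards [hne] with y hy
    exact (tendsto_regKernel (sub_ne_zero.2 hy.symm)).const_mul _

lemma tendsto_integral_approx_identity {m : ℕ} (hm : Fintype.card ι = 2 * m + 2)
    {g : EuclideanSpace ℝ ι → ℝ} (hg : Continuous g) (hc : HasCompactSupport g)
    (x : EuclideanSpace ℝ ι) :
    Tendsto (fun ε : ℝ => ∫ y, g y * (ε ^ 2 * regKernel (m + 2) (ε ^ 2) (x - y))) (𝓝[>] 0)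
      (𝓝 (g x * ∫ w : EuclideanSpace ℝ ι, regKernel (m + 2) 1 w)) := by
  have hint : Integrable (regKernel (m + 2) 1 : EuclideanSpace ℝ ι → ℝ) :=
    integrable_regKernel_one volume (by simp [hm]; omega)
  obtain ⟨C, hC⟩ := hg.bounded_above_of_compact_support hc
  have hlim : Tendsto (fun ε : ℝ => ∫ w : EuclideanSpace ℝ ι, g (x + ε • w) * regKernel (m + 2) 1 w) (𝓝[>] 0)
      (𝓝 (∫ w : EuclideanSpace ℝ ι, g x * regKernel (m + 2) 1 w)) := by
    refine tendsto_integral_filter_of_dominated_convergence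
      (fun w => C * regKernel (m + 2) 1 w) (Eventually.of_forall fun ε => ?_)
      (Eventually.of_forall fun ε => Eventually.of_forall fun w => ?_) (hint.const_mul C)
      (Eventually.of_forall fun w => ?_)
    · have : Continuous fun w : EuclideanSpace ℝ ι => g (x + ε • w) :=
        hg.comp (by fun_prop : Continuous fun w : EuclideanSpace ℝ ι => x + ε • w)
      exact (this.measurable.mul (measurable_regKernel (m + 2) 1)).aestronglyMeasurable
    · rw [norm_mul, Real.norm_of_nonneg (regKernel_nonneg _ zero_le_one _)]
      exact mul_le_mul_of_nonneg_right (hC _) (regKernel_nonneg (m + 2) zero_le_one w)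
    · have : Continuous fun ε : ℝ => g (x + ε • w) := hg.comp (by fun_prop)
      have h0 := (this.tendsto 0).mono_left (nhdsWithin_le_nhds (s := Set.Ioi 0))
      simp only [zero_smul, add_zero] at h0
      exact h0.mul_const _
  rw [integral_const_mul] at hlim
  refine hlim.congr' ?_
  filter_upwards [self_mem_nhdsWithin] with ε (hε : 0 < ε)
  set F : EuclideanSpace ℝ ι → ℝ := fun z => g (x + z) * (ε ^ 2 * regKernel (m + 2) (ε ^ 2) z)
    with hF
  have e1 : ∀ w : EuclideanSpace ℝ ι, g (x + ε • w) * regKernel (m + 2) 1 w =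
      ε ^ (2 * m + 2) * F (ε • w) := by
    intro w
    have : regKernel (m + 2) (ε ^ 2) (ε • w) =
        (ε ^ (2 * m + 4))⁻¹ * regKernel (m + 2) 1 w := by
      simp only [regKernel, norm_smul, Real.norm_of_nonneg hε.le]
      rw [← mul_inv]
      congr 1
      rw [show (ε * ‖w‖) ^ 2 + ε ^ 2 = ε ^ 2 * (‖w‖ ^ 2 + 1) by ring, mul_pow, ← pow_mul]
      ring
    simp only [hF, this]
    field_simp
    ring
  have e2 : (∫ w, g (x + ε • w) * regKernel (m + 2) 1 w) =
      ε ^ (2 * m + 2) * ∫ w, F (ε • w) := by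
    rw [← integral_const_mul]
    exact integral_congr_ae (Eventually.of_forall e1)
  rw [e2, Measure.integral_comp_smul_of_nonneg volume F ε (hR := hε.le),
    finrank_euclideanSpace, hm, smul_eq_mul, ← mul_assoc, mul_inv_cancel₀ (by positivity), one_mul,
    ← integral_sub_right_eq_self F x]
  refine integral_congr_ae (Eventually.of_forall fun y => ?_)
  simp only [hF, add_sub_cancel, regKernel, norm_sub_rev y x]

variable [DecidableEq ι]

lemma tendsto_integral_cutoffKernel [Nonempty ι] {m : ℕ} {u χ : EuclideanSpace ℝ ι → ℝ}
    (hu : ContDiff ℝ 2 u) (hχ : ContDiff ℝ 2 χ) (hc : HasCompactSupport χ)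
    (h1 : ∀ y ∈ Metric.ball (0 : EuclideanSpace ℝ ι) 1, χ y = 1)
    {x : EuclideanSpace ℝ ι} (hx : ‖x‖ < 1) :
    Tendsto (fun ε : ℝ => ∫ y, u y * cutoffKernel m (ε ^ 2) χ x y) (𝓝[>] 0)
      (𝓝 (∫ y, u y * cutoffKernel m 0 χ x y)) := by
  have hne : ∀ᵐ y : EuclideanSpace ℝ ι, y ≠ x := by
    simp [ae_iff]
  have cD : Continuous fun y => fderiv ℝ χ y (x - y) :=
    (hχ.continuous_fderiv (by norm_num)).clm_apply (by fun_prop)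
  have cL : Continuous (eLap χ) := continuous_eLap hχ
  have sD : HasCompactSupport fun y => fderiv ℝ χ y (x - y) :=
    (hc.fderiv ℝ).mono fun y hy => by
      contrapose! hy; simp [Function.notMem_support.1 hy]
  have sL : HasCompactSupport (eLap χ) := by
    refine hc.mono' fun y hy => ?_
    by_contra hy'
    have h0 : χ =ᶠ[𝓝 y] fun _ => 0 := notMem_tsupport_iff_eventuallyEq.1 hy'
    exact hy (by rw [h0.eLap_eq]; simp [eLap, secondDirDeriv])
  have hvan : ∀ y, ‖y‖ < 1 → fderiv ℝ χ y (x - y) = 0 ∧ eLap χ y = 0 := by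
    intro y hy
    have h0 : χ =ᶠ[𝓝 y] fun _ => 1 := by
      filter_upwards [Metric.isOpen_ball.mem_nhds (mem_ball_zero_iff.2 hy)] with z hz using h1 z hz
    refine ⟨by simp [h0.fderiv_eq], by rw [h0.eLap_eq]; simp [eLap, secondDirDeriv]⟩
  set δ := 1 - ‖x‖ with hδ
  have hδ0 : 0 < δ := by linarith
  have hker : ∀ (k : ℕ) (ε : ℝ) y, 1 ≤ ‖y‖ → regKernel k (ε ^ 2) (x - y) ≤ (δ ^ (2 * k))⁻¹ := by
    intro k ε y hy
    have hd : δ ≤ ‖x - y‖ := by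
      have := norm_sub_norm_le y x
      rw [norm_sub_rev] at this
      linarith
    have hxy : x - y ≠ 0 := norm_pos_iff.1 (hδ0.trans_le hd)
    refine (regKernel_le k (sq_nonneg ε) hxy).trans ?_
    rw [regKernel_zero_eq]
    gcongr
  refine tendsto_integral_filter_of_dominated_convergence
    (fun y => ‖u y‖ * (4 * m * ‖fderiv ℝ χ y (x - y)‖ * (δ ^ (2 * (m + 1)))⁻¹ +
      (δ ^ (2 * m))⁻¹ * ‖eLap χ y‖)) (Eventually.of_forall fun ε => ?_)
    (Eventually.of_forall fun ε => Eventually.of_forall fun y => ?_) ?_ ?_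
  · have hk : ∀ k, Measurable fun y => regKernel k (ε ^ 2) (x - y) := fun k =>
      (measurable_regKernel k _).comp (measurable_const.sub measurable_id)
    exact (hu.continuous.measurable.mul (((cD.measurable.const_mul _).mul (hk _)).add
      ((hk _).mul cL.measurable))).aestronglyMeasurable
  · rcases lt_or_ge ‖y‖ 1 with hy | hy
    · simp [cutoffKernel, hvan y hy]
    · rw [norm_mul]
      refine mul_le_mul_of_nonneg_left ((norm_add_le _ _).trans ?_) (norm_nonneg _)
      rw [norm_mul, norm_mul _ (eLap χ y), norm_mul (4 * m : ℝ),
        Real.norm_of_nonneg (regKernel_nonneg (m + 1) (sq_nonneg ε) _),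
        Real.norm_of_nonneg (regKernel_nonneg m (sq_nonneg ε) _),
        Real.norm_of_nonneg (show (0 : ℝ) ≤ 4 * m by positivity)]
      gcongr
      · exact hker _ _ _ hy
      · exact hker _ _ _ hy
  · refine Continuous.integrable_of_hasCompactSupport ?_ ?_
    · have := hu.continuous
      fun_prop
    · refine HasCompactSupport.mul_left (HasCompactSupport.add ?_ ?_)
      · exact HasCompactSupport.mul_right (HasCompactSupport.mul_left sD.norm)
      · exact HasCompactSupport.mul_left sL.norm
  · filter_upwards [hne] with y hy
    have hxy := sub_ne_zero.2 hy.symm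
    exact (((tendsto_regKernel hxy).const_mul _).add
      ((tendsto_regKernel hxy).mul_const _)).const_mul _

theorem kernelConst_mul_eq [Nonempty ι] {m : ℕ} (hm : Fintype.card ι = 2 * m + 2)
    {u χ : EuclideanSpace ℝ ι → ℝ}
    (hu : ContDiff ℝ 2 u) (hχ : ContDiff ℝ 2 χ) (hc : HasCompactSupport χ)
    (h1 : ∀ y ∈ Metric.ball (0 : EuclideanSpace ℝ ι) 1, χ y = 1)
    {x : EuclideanSpace ℝ ι} (hx : ‖x‖ < 1) :
    kernelConst ι m * u x = (∫ y, u y * cutoffKernel m 0 χ x y) -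
      ∫ y, χ y * eLap u y * regKernel m 0 (x - y) := by
  have cont_u := hu.continuous
  have cont_χ := hχ.continuous
  have cont_Lu := continuous_eLap hu
  have cont_Lχ := continuous_eLap hχ
  have t1 := tendsto_integral_mul_regKernel (m := m) (by omega) (cont_χ.mul cont_Lu)
    hc.mul_right x
  have t2 := tendsto_integral_cutoffKernel (m := m) hu hχ hc h1 hx
  have t3 := (tendsto_integral_approx_identity hm (cont_u.mul cont_χ) hc.mul_left x).const_mul
    (4 * m * (m + 1) : ℝ)
  have key : ∀ᶠ ε : ℝ in 𝓝[>] 0,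
      (∫ y, u y * cutoffKernel m (ε ^ 2) χ x y) -
        ∫ y, χ y * eLap u y * regKernel m (ε ^ 2) (x - y) =
      4 * m * (m + 1) * ∫ y, u y * χ y * (ε ^ 2 * regKernel (m + 2) (ε ^ 2) (x - y)) := by
    filter_upwards [self_mem_nhdsWithin] with ε (hε : 0 < ε)
    have hk := contDiff_regKernel_sub m (pow_pos hε 2) x (n := 2)
    have hk' : ∀ k, Continuous fun y => regKernel k (ε ^ 2) (x - y) := fun k =>
      (contDiff_regKernel_sub k (pow_pos hε 2) x (n := 0)).continuous
    have hibp := integral_mul_eLap_comm hu (hχ.mul hk) hc.mul_right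
    have hexp : ∀ y, eLap (fun y => χ y * regKernel m (ε ^ 2) (x - y)) y =
        cutoffKernel m (ε ^ 2) χ x y -
          4 * m * (m + 1) * (χ y * (ε ^ 2 * regKernel (m + 2) (ε ^ 2) (x - y))) := by
      intro y
      have hdir : fderiv ℝ χ y (x - y) = ∑ i, fderiv ℝ χ y (EuclideanSpace.single i 1) * (x - y) i := by
        conv_lhs => rw [← (EuclideanSpace.basisFun ι ℝ).sum_repr (x - y)]
        simp [map_sum, mul_comm]
      rw [eLap_mul hχ hk, eLap_regKernel_sub hm (pow_pos hε 2), cutoffKernel, hdir]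
      simp only [fderiv_regKernel_sub m (pow_pos hε 2), EuclideanSpace.inner_single_right]
      simp only [Finset.mul_sum, Finset.sum_mul, conj_trivial, one_mul]
      have : ∀ i, 2 * (fderiv ℝ χ y (EuclideanSpace.single i 1) *
          (2 * m * (x - y) i * regKernel (m + 1) (ε ^ 2) (x - y))) =
          4 * m * (fderiv ℝ χ y (EuclideanSpace.single i 1) * (x - y) i) *
            regKernel (m + 1) (ε ^ 2) (x - y) := fun i => by ring
      simp only [this]
      ring
    have hi1 : Integrable fun y => u y * (χ y * (ε ^ 2 * regKernel (m + 2) (ε ^ 2) (x - y))) :=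
      (cont_u.mul (cont_χ.mul (continuous_const.mul (hk' _)))).integrable_of_hasCompactSupport
        (HasCompactSupport.mul_left hc.mul_right)
    have hi2 : Integrable fun y => u y * eLap (fun y => χ y * regKernel m (ε ^ 2) (x - y)) y := by
      refine (cont_u.mul (continuous_eLap (hχ.mul hk))).integrable_of_hasCompactSupport
        (HasCompactSupport.mul_left ?_)
      refine hc.mono' fun y hy => ?_
      by_contra hy'
      have h0 : χ =ᶠ[𝓝 y] fun _ => 0 := notMem_tsupport_iff_eventuallyEq.1 hy'
      have h0' : (fun y => χ y * regKernel m (ε ^ 2) (x - y)) =ᶠ[𝓝 y] fun _ => 0 := by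
        filter_upwards [h0] with z hz
        simp [hz]
      exact hy (by rw [h0'.eLap_eq]; simp [eLap, secondDirDeriv])
    have e1 : (∫ y, u y * cutoffKernel m (ε ^ 2) χ x y) =
        (∫ y, u y * eLap (fun y => χ y * regKernel m (ε ^ 2) (x - y)) y) +
        4 * m * (m + 1) * ∫ y, u y * (χ y * (ε ^ 2 * regKernel (m + 2) (ε ^ 2) (x - y))) := by
      rw [← integral_const_mul, ← integral_add hi2 (hi1.const_mul _)]
      refine integral_congr_ae (Eventually.of_forall fun y => ?_)
      simp only [hexp]
      ring
    rw [e1, hibp]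
    have e2 : ∀ y, χ y * regKernel m (ε ^ 2) (x - y) * eLap u y =
      χ y * eLap u y * regKernel m (ε ^ 2) (x - y) := fun y => by ring
    simp only [e2, mul_assoc]
    ring
  have := tendsto_nhds_unique (t3.congr' (key.mono fun ε h => h.symm)) (t2.sub t1)
  simp only [Pi.mul_apply] at this
  rw [h1 x (by simpa using hx)] at this
  rw [← this, kernelConst]
  ring

omit [DecidableEq ι] in
lemma kernelConst_pos {m : ℕ} (hm1 : 1 ≤ m) (hm : Fintype.card ι = 2 * m + 2) :
    0 < kernelConst ι m := by
  have hint : Integrable (regKernel (m + 2) 1 : EuclideanSpace ℝ ι → ℝ) :=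
    integrable_regKernel_one volume (by simp [hm]; omega)
  have : 0 < ∫ w : EuclideanSpace ℝ ι, regKernel (m + 2) 1 w := by
    rw [integral_pos_iff_support_of_nonneg (fun w => regKernel_nonneg _ zero_le_one w) hint]
    have : Function.support (regKernel (m + 2) 1 : EuclideanSpace ℝ ι → ℝ) = Set.univ := by
      ext w
      simp only [Function.mem_support, Set.mem_univ, iff_true, regKernel]
      positivity
    rw [this]
    exact Measure.measure_univ_pos.2 (NeZero.ne _)
  have : (0 : ℝ) < m := by exact_mod_cast hm1
  unfold kernelConst
  positivity

end Representation

/-- The coefficients of the formal expansion `(1 - u + v)^{-m} = ∑ k, gegCoeff m k u v`, where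
`u` has degree one and `v` has degree two. -/
noncomputable def gegCoeff : ℕ → ℕ → ℝ → ℝ → ℝ
  | 0, 0, _, _ => 1
  | 0, _ + 1, _, _ => 0
  | _ + 1, 0, _, _ => 1
  | m + 1, 1, u, v => u * gegCoeff (m + 1) 0 u v + gegCoeff m 1 u v
  | m + 1, k + 2, u, v =>
    u * gegCoeff (m + 1) (k + 1) u v - v * gegCoeff (m + 1) k u v + gegCoeff m (k + 2) u v

section Gegenbauer

lemma gegCoeff_zero (m : ℕ) (u v : ℝ) : gegCoeff m 0 u v = 1 := by
  cases m <;> simp [gegCoeff]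

/-- Induction principle following the recursion of `gegCoeff`. -/
lemma gegCoeff_induction {p : ℕ → ℕ → Prop} (h00 : p 0 0) (h0 : ∀ k, p 0 (k + 1))
    (hs0 : ∀ m, p (m + 1) 0) (hs1 : ∀ m, p (m + 1) 0 → p m 1 → p (m + 1) 1)
    (hs2 : ∀ m k, p (m + 1) (k + 1) → p (m + 1) k → p m (k + 2) → p (m + 1) (k + 2)) :
    ∀ m k, p m k := by
  intro m
  induction m with
  | zero => rintro (_ | k); exacts [h00, h0 k]
  | succ m ih =>
    have : ∀ k, p (m + 1) k ∧ p (m + 1) (k + 1) := by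
      intro k
      induction k with
      | zero => exact ⟨hs0 m, hs1 m (hs0 m) (ih 1)⟩
      | succ k ihk => exact ⟨ihk.2, hs2 m k ihk.2 ihk.1 (ih _)⟩
    exact fun k => (this k).1

lemma continuous_gegCoeff (m k : ℕ) : Continuous fun z : ℝ × ℝ => gegCoeff m k z.1 z.2 := by
  refine gegCoeff_induction (p := fun m k => Continuous fun z : ℝ × ℝ => gegCoeff m k z.1 z.2)
    ?_ ?_ ?_ ?_ ?_ m k
  · simpa [gegCoeff] using continuous_const
  · intro k; simpa [gegCoeff] using continuous_const
  · intro m; simpa [gegCoeff] using continuous_const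
  · intro m h1 h2; simp only [gegCoeff]
    simp only [gegCoeff] at h1
    fun_prop
  · intro m k h1 h2 h3; simp only [gegCoeff]; fun_prop

lemma abs_gegCoeff_le {a u v : ℝ} (ha : 0 ≤ a) (hu : |u| ≤ 2 * a) (hv : |v| ≤ a ^ 2) (m k : ℕ) :
    |gegCoeff m k u v| ≤ (9 / 2) ^ m * (3 * a) ^ k := by
  refine gegCoeff_induction (p := fun m k => |gegCoeff m k u v| ≤ (9 / 2) ^ m * (3 * a) ^ k)
    ?_ ?_ ?_ ?_ ?_ m k
  · simp [gegCoeff]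
  · intro k; simp only [gegCoeff, abs_zero]; positivity
  · intro m
    simpa [gegCoeff] using one_le_pow₀ (n := m + 1) (show (1 : ℝ) ≤ 9 / 2 by norm_num)
  · intro m _ h2
    simp only [gegCoeff, mul_one]
    have h1 : (1 : ℝ) ≤ (9 / 2) ^ m := one_le_pow₀ (by norm_num)
    calc |u + gegCoeff m 1 u v| ≤ |u| + |gegCoeff m 1 u v| := abs_add_le _ _
      _ ≤ 2 * a + (9 / 2) ^ m * (3 * a) ^ 1 := add_le_add hu h2
      _ ≤ 2 * (a * (9 / 2) ^ m) + (9 / 2) ^ m * (3 * a) ^ 1 := by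
        gcongr; exact le_mul_of_one_le_right ha h1
      _ ≤ _ := by
        rw [pow_succ (9 / 2 : ℝ)]
        have : 0 ≤ a * (9 / 2) ^ m := by positivity
        linarith
  · intro m k h1 h2 h3
    simp only [gegCoeff]
    calc _ ≤ |u| * |gegCoeff (m + 1) (k + 1) u v| + |v| * |gegCoeff (m + 1) k u v|
          + |gegCoeff m (k + 2) u v| := by
          rw [← abs_mul, ← abs_mul]
          exact (abs_add_le _ _).trans (add_le_add_left (abs_sub _ _) _)
      _ ≤ 2 * a * ((9 / 2) ^ (m + 1) * (3 * a) ^ (k + 1)) + a ^ 2 * ((9 / 2) ^ (m + 1) * (3 * a) ^ k)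
          + (9 / 2) ^ m * (3 * a) ^ (k + 2) := by gcongr
      _ ≤ _ := by
        rw [pow_succ (9 / 2 : ℝ), pow_add (3 * a), pow_succ (3 * a)]
        apply le_of_eq
        ring

lemma gegCoeff_sum_succ (m N : ℕ) (u v : ℝ) :
    (1 - u + v) * ∑ k ∈ Finset.range (N + 2), gegCoeff (m + 1) k u v =
      ∑ k ∈ Finset.range (N + 2), gegCoeff m k u v - u * gegCoeff (m + 1) (N + 1) u v +
        v * gegCoeff (m + 1) N u v + v * gegCoeff (m + 1) (N + 1) u v := by
  induction N with
  | zero => simp [Finset.sum_range_succ, gegCoeff, gegCoeff_zero]; ring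
  | succ N ih =>
    rw [Finset.sum_range_succ, mul_add, ih, Finset.sum_range_succ _ (N + 2)]
    simp only [gegCoeff]
    ring

lemma exists_gegCoeff_remainder (m : ℕ) : ∃ C : ℝ, 0 ≤ C ∧ ∀ a u v : ℝ, 0 ≤ a → a ≤ 1 / 4 →
    |u| ≤ 2 * a → |v| ≤ a ^ 2 → ∀ N,
    |((1 - u + v) ^ m)⁻¹ - ∑ k ∈ Finset.range N, gegCoeff m k u v| ≤ C * (3 * a) ^ N := by
  induction m with
  | zero =>
    refine ⟨1, zero_le_one, fun a u v ha _ _ _ N => ?_⟩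
    rcases N with _ | N
    · simp
    · rw [Finset.sum_range_succ']
      simp [gegCoeff]
      positivity
  | succ m ih =>
    obtain ⟨C, hC0, hC⟩ := ih
    refine ⟨16 / 7 * (C + (9 / 2) ^ (m + 1)), by positivity, fun a u v ha ha4 hu hv N => ?_⟩
    have hq : 7 / 16 ≤ 1 - u + v := by
      have := abs_le.1 hu; have := abs_le.1 hv
      nlinarith
    have hq0 : 0 < 1 - u + v := by linarith
    set q := 1 - u + v with hqdef
    have key : |q * ((q ^ (m + 1))⁻¹ - ∑ k ∈ Finset.range N, gegCoeff (m + 1) k u v)| ≤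
        (C + (9 / 2) ^ (m + 1)) * (3 * a) ^ N := by
      have e0 : q * (q ^ (m + 1))⁻¹ = (q ^ m)⁻¹ := by
        rw [pow_succ, mul_inv]; field_simp
      have hN := hC a u v ha ha4 hu hv N
      have hb := abs_gegCoeff_le ha hu hv (m + 1)
      rw [mul_sub, e0]
      rcases N with _ | _ | N
      · simp only [Finset.range_zero, Finset.sum_empty, mul_zero, pow_zero, mul_one] at hN ⊢
        exact hN.trans (le_add_of_nonneg_right (by positivity))
      · simp only [zero_add, Finset.range_one, Finset.sum_singleton, gegCoeff_zero, mul_one,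
          pow_one] at hN ⊢
        have h1 : (1 : ℝ) ≤ (9 / 2) ^ (m + 1) := one_le_pow₀ (by norm_num)
        rw [show (q ^ m)⁻¹ - q = ((q ^ m)⁻¹ - 1) + (u - v) by rw [hqdef]; ring]
        have h2 : |u - v| ≤ 3 * a := by
          refine (abs_sub _ _).trans ?_
          nlinarith
        calc _ ≤ C * (3 * a) + 1 * (3 * a) := (abs_add_le _ _).trans (by linarith)
          _ ≤ _ := by rw [← add_mul]; gcongr
      · rw [gegCoeff_sum_succ]
        calc _ = |((q ^ m)⁻¹ - ∑ k ∈ Finset.range (N + 2), gegCoeff m k u v) +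
              (u * gegCoeff (m + 1) (N + 1) u v - v * gegCoeff (m + 1) N u v
                - v * gegCoeff (m + 1) (N + 1) u v)| := by congr 1; ring
          _ ≤ C * (3 * a) ^ (N + 2) + (|u| * |gegCoeff (m + 1) (N + 1) u v| +
              |v| * |gegCoeff (m + 1) N u v| + |v| * |gegCoeff (m + 1) (N + 1) u v|) := by
            rw [← abs_mul, ← abs_mul, ← abs_mul]
            refine (abs_add_le _ _).trans (add_le_add hN ?_)
            exact (abs_sub _ _).trans (add_le_add_left (abs_sub _ _) _)
          _ ≤ C * (3 * a) ^ (N + 2) + (2 * a * ((9 / 2) ^ (m + 1) * (3 * a) ^ (N + 1)) +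
              a ^ 2 * ((9 / 2) ^ (m + 1) * (3 * a) ^ N) +
              a ^ 2 * ((9 / 2) ^ (m + 1) * (3 * a) ^ (N + 1))) := by
            have := hb (N + 1); have := hb N
            gcongr
          _ ≤ _ := by
            rw [pow_succ (3 * a) (N + 1), pow_succ (3 * a)]
            have h1 : 0 ≤ (9 / 2 : ℝ) ^ (m + 1) * (3 * a) ^ N * a ^ 2 := by positivity
            nlinarith
    rw [abs_mul, abs_of_pos hq0] at key
    have h0 : 0 ≤ |(q ^ (m + 1))⁻¹ - ∑ k ∈ Finset.range N, gegCoeff (m + 1) k u v| := abs_nonneg _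
    nlinarith

end Gegenbauer

/-- The degree `k` (in `x`) term in the expansion of `‖x - y‖^{-2m}`. -/
noncomputable def kernelTerm {E : Type*} [NormedAddCommGroup E] [InnerProductSpace ℝ E]
    (m k : ℕ) (x y : E) : ℝ :=
  (‖y‖ ^ (2 * m))⁻¹ * gegCoeff m k (2 * inner ℝ x y / ‖y‖ ^ 2) (‖x‖ ^ 2 / ‖y‖ ^ 2)

section KernelTerm

variable {E : Type*} [NormedAddCommGroup E] [InnerProductSpace ℝ E]

lemma abs_two_inner_div_le {x y : E} (hy : y ≠ 0) :
    |2 * inner ℝ x y / ‖y‖ ^ 2| ≤ 2 * (‖x‖ / ‖y‖) := by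
  have hy' : 0 < ‖y‖ := norm_pos_iff.2 hy
  rw [abs_div, abs_mul, abs_two, abs_of_pos (pow_pos hy' 2), div_le_iff₀ (by positivity)]
  have := abs_real_inner_le_norm x y
  calc _ ≤ 2 * (‖x‖ * ‖y‖) := by gcongr
    _ = _ := by field_simp

lemma abs_kernelTerm_le (m k : ℕ) (x : E) {y : E} (hy : y ≠ 0) :
    |kernelTerm m k x y| ≤ (9 / 2) ^ m * (3 * ‖x‖) ^ k * (‖y‖ ^ (2 * m + k))⁻¹ := by
  have hy' : 0 < ‖y‖ := norm_pos_iff.2 hy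
  have h := abs_gegCoeff_le (a := ‖x‖ / ‖y‖) (by positivity) (abs_two_inner_div_le (x := x) hy)
    (v := ‖x‖ ^ 2 / ‖y‖ ^ 2) (by rw [abs_of_nonneg (by positivity), div_pow]) m k
  rw [kernelTerm, abs_mul, abs_of_pos (by positivity)]
  calc _ ≤ (‖y‖ ^ (2 * m))⁻¹ * ((9 / 2) ^ m * (3 * (‖x‖ / ‖y‖)) ^ k) := by gcongr
    _ = _ := by rw [pow_add, mul_inv, ← mul_div_assoc, div_pow, div_eq_mul_inv]; ring

lemma exists_kernel_remainder (m : ℕ) : ∃ C : ℝ, 0 ≤ C ∧ ∀ (N : ℕ) (x y : E), y ≠ 0 →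
    4 * ‖x‖ ≤ ‖y‖ →
    |(‖x - y‖ ^ (2 * m))⁻¹ - ∑ k ∈ Finset.range N, kernelTerm m k x y| ≤
      C * (3 * ‖x‖) ^ N * (‖y‖ ^ (2 * m + N))⁻¹ := by
  obtain ⟨C, hC0, hC⟩ := exists_gegCoeff_remainder m
  refine ⟨C, hC0, fun N x y hy hxy => ?_⟩
  have hy' : 0 < ‖y‖ := norm_pos_iff.2 hy
  have h := hC (‖x‖ / ‖y‖) _ (‖x‖ ^ 2 / ‖y‖ ^ 2) (by positivity)
    (by rw [div_le_iff₀ hy']; linarith) (abs_two_inner_div_le (x := x) hy)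
    (by rw [abs_of_nonneg (by positivity), div_pow]) N
  have e : (‖x - y‖ ^ (2 * m))⁻¹ - ∑ k ∈ Finset.range N, kernelTerm m k x y =
      (‖y‖ ^ (2 * m))⁻¹ * (((1 - 2 * inner ℝ x y / ‖y‖ ^ 2 + ‖x‖ ^ 2 / ‖y‖ ^ 2) ^ m)⁻¹ -
        ∑ k ∈ Finset.range N, gegCoeff m k (2 * inner ℝ x y / ‖y‖ ^ 2) (‖x‖ ^ 2 / ‖y‖ ^ 2)) := by
    rw [mul_sub, Finset.mul_sum]
    congr 1
    rw [pow_mul, pow_mul, ← mul_inv, ← mul_pow, norm_sub_sq_real]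
    congr 2
    field_simp
    ring
  rw [e, abs_mul, abs_of_pos (by positivity)]
  calc _ ≤ (‖y‖ ^ (2 * m))⁻¹ * (C * (3 * (‖x‖ / ‖y‖)) ^ N) := by gcongr
    _ = _ := by rw [pow_add, mul_inv, ← mul_div_assoc, div_pow]; field_simp

lemma measurable_kernelTerm [MeasurableSpace E] [BorelSpace E] (m k : ℕ) (x : E) :
    Measurable (kernelTerm m k x) := by
  unfold kernelTerm
  have h1 : Measurable fun y : E => 2 * inner ℝ x y / ‖y‖ ^ 2 :=
    Measurable.div (by fun_prop : Continuous fun y : E => 2 * inner ℝ x y).measurable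
      (measurable_norm.pow_const 2)
  have h2 : Measurable fun y : E => ‖x‖ ^ 2 / ‖y‖ ^ 2 :=
    measurable_const.div (measurable_norm.pow_const 2)
  exact (measurable_norm.pow_const _).inv.mul
    ((continuous_gegCoeff m k).measurable.comp (h1.prodMk h2))

end KernelTerm

/-- Functions on `ℝ^ι` given by homogeneous polynomials of degree `k`. -/
noncomputable def homogPolyFun (ι : Type*) (k : ℕ) : Submodule ℝ (EuclideanSpace ℝ ι → ℝ) where
  carrier := {f | ∃ P : MvPolynomial ι ℝ, P.IsHomogeneous k ∧
    ∀ x : EuclideanSpace ℝ ι, f x = MvPolynomial.eval (fun i => x i) P}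
  add_mem' := by
    rintro f g ⟨P, hP, hf⟩ ⟨Q, hQ, hg⟩
    exact ⟨P + Q, hP.add hQ, fun x => by simp [hf, hg]⟩
  zero_mem' := ⟨0, MvPolynomial.isHomogeneous_zero _ _ _, fun x => by simp⟩
  smul_mem' := by
    rintro c f ⟨P, hP, hf⟩
    exact ⟨c • P, (MvPolynomial.homogeneousSubmodule ι ℝ k).smul_mem c hP,
      fun x => by simp [hf]⟩

section HomogPolyFun

variable {ι : Type*}

lemma mem_homogPolyFun {k : ℕ} {f : EuclideanSpace ℝ ι → ℝ} : f ∈ homogPolyFun ι k ↔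
    ∃ P : MvPolynomial ι ℝ, P.IsHomogeneous k ∧
      ∀ x : EuclideanSpace ℝ ι, f x = MvPolynomial.eval (fun i => x i) P := Iff.rfl

lemma homogPolyFun_mul {j k : ℕ} {f g : EuclideanSpace ℝ ι → ℝ} (hf : f ∈ homogPolyFun ι j)
    (hg : g ∈ homogPolyFun ι k) : (fun x => f x * g x) ∈ homogPolyFun ι (j + k) := by
  obtain ⟨P, hP, hf⟩ := hf
  obtain ⟨Q, hQ, hg⟩ := hg
  exact ⟨P * Q, hP.mul hQ, fun x => by simp [hf, hg]⟩

lemma homogPolyFun_const (c : ℝ) : (fun _ => c) ∈ homogPolyFun ι 0 :=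
  ⟨MvPolynomial.C c, MvPolynomial.isHomogeneous_C _ _, fun x => by simp⟩

lemma homogPolyFun_const_mul {k : ℕ} {f : EuclideanSpace ℝ ι → ℝ} (c : ℝ)
    (hf : f ∈ homogPolyFun ι k) : (fun x => c * f x) ∈ homogPolyFun ι k :=
  (homogPolyFun ι k).smul_mem c hf

lemma homogPolyFun_smul {k : ℕ} {f : EuclideanSpace ℝ ι → ℝ} (hf : f ∈ homogPolyFun ι k)
    (c : ℝ) (x : EuclideanSpace ℝ ι) : f (c • x) = c ^ k * f x := by
  obtain ⟨P, hP, hf⟩ := hf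
  rw [hf, hf]
  rw [MvPolynomial.eval_eq, MvPolynomial.eval_eq, Finset.mul_sum]
  refine Finset.sum_congr rfl fun e he => ?_
  have hk : ∑ i ∈ e.support, e i = k := by
    rw [← hP (MvPolynomial.mem_support_iff.1 he), Finsupp.weight_apply]
    simp [Finsupp.sum]
  simp only [PiLp.smul_apply, smul_eq_mul, mul_pow, Finset.prod_mul_distrib,
    Finset.prod_pow_eq_pow_sum, hk]
  ring

variable [Fintype ι]

lemma homogPolyFun_linear [DecidableEq ι] (L : EuclideanSpace ℝ ι →ₗ[ℝ] ℝ) : (fun x => L x) ∈ homogPolyFun ι 1 := by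
  refine ⟨∑ i, MvPolynomial.C (L (EuclideanSpace.single i 1)) * MvPolynomial.X i,
    MvPolynomial.IsHomogeneous.sum _ _ _ fun i _ => ?_, fun x => ?_⟩
  · simpa using (MvPolynomial.isHomogeneous_C ι _).mul (MvPolynomial.isHomogeneous_X ℝ i)
  · conv_lhs => rw [← (EuclideanSpace.basisFun ι ℝ).sum_repr x]
    simp [map_sum, mul_comm]

lemma homogPolyFun_norm_sq : (fun x : EuclideanSpace ℝ ι => ‖x‖ ^ 2) ∈ homogPolyFun ι 2 := by
  refine ⟨∑ i, MvPolynomial.X i ^ 2,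
    MvPolynomial.IsHomogeneous.sum _ _ _ fun i _ => MvPolynomial.isHomogeneous_X_pow i 2, fun x => ?_⟩
  simp [EuclideanSpace.norm_sq_eq]

instance (k : ℕ) : FiniteDimensional ℝ (homogPolyFun ι k) := by
  let e : MvPolynomial ι ℝ →ₗ[ℝ] (EuclideanSpace ℝ ι → ℝ) :=
    { toFun := fun P x => MvPolynomial.eval (fun i => x i) P
      map_add' := fun P Q => by ext x; simp
      map_smul' := fun c P => by ext x; simp }
  have : homogPolyFun ι k = (MvPolynomial.homogeneousSubmodule ι ℝ k).map e := by
    ext f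
    rw [mem_homogPolyFun, Submodule.mem_map]
    exact exists_congr fun P => and_congr Iff.rfl
      ⟨fun h => funext fun x => (h x).symm, fun h x => (congrFun h x).symm⟩
  rw [this]
  exact Module.Finite.iff_fg.2 ((MvPolynomial.homogeneousSubmodule_fg ι ℝ k).map e)

omit [Fintype ι] in
/-- A finite-dimensional space of functions is closed under integration with parameters. -/
lemma integral_mem_of_finiteDimensional {X Y : Type*} [MeasurableSpace Y] {μ : Measure Y}
    (S : Submodule ℝ (X → ℝ)) [FiniteDimensional ℝ S] {g : Y → X → ℝ} (hS : ∀ y, g y ∈ S)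
    (hg : ∀ x, Integrable (fun y => g y x) μ) : (fun x => ∫ y, g y x ∂μ) ∈ S := by
  let G : Y → S := fun y => ⟨g y, hS y⟩
  let ev : X → Module.Dual ℝ S := fun x => (LinearMap.proj x).comp S.subtype
  let T : Submodule ℝ (Module.Dual ℝ S) :=
    { carrier := {l | Integrable (fun y => l (G y)) μ}
      add_mem' := fun h1 h2 => Integrable.add h1 h2
      zero_mem' := by simp
      smul_mem' := fun c l h => Integrable.const_mul h c }
  have hT : T = ⊤ := by
    have h1 : T.dualCoannihilator = ⊥ := by
      refine (Submodule.eq_bot_iff _).2 fun f hf => Subtype.ext (funext fun x => ?_)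
      exact (Submodule.mem_dualCoannihilator f).1 hf (ev x) (hg x)
    rw [← Subspace.dualCoannihilator_dualAnnihilator_eq (W := T), h1]
    simp
  let b := Module.finBasis ℝ S
  have hb : (fun x => ∫ y, g y x ∂μ) =
      ∑ i, (∫ y, b.coord i (G y) ∂μ) • ((b i : S) : X → ℝ) := by
    ext x
    have e : ∀ y, g y x = ∑ i, b.coord i (G y) * (b i : X → ℝ) x := by
      intro y
      have := congrArg (fun f : S => (f : X → ℝ) x) (b.sum_repr (G y)).symm
      simpa only [Submodule.coe_sum, Finset.sum_apply, Submodule.coe_smul, Pi.smul_apply,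
        smul_eq_mul, Module.Basis.coord_apply] using this
    simp only [e]
    rw [integral_finsetSum]
    · simp [integral_mul_const]
    · intro i _
      have : b.coord i ∈ T := hT ▸ Submodule.mem_top
      exact Integrable.mul_const this _
  rw [hb]
  exact Submodule.sum_mem _ fun i _ => S.smul_mem _ (b i).2

end HomogPolyFun

section Vanishing

lemma eq_zero_of_abs_sum_mul_pow_le {N : ℕ} {g : ℕ → ℝ} {M : ℝ}
    (h : ∀ᶠ s : ℝ in 𝓝[>] 0, |∑ k ∈ Finset.range N, g k * s ^ k| ≤ M * s ^ N) :
    ∀ k < N, g k = 0 := by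
  induction N generalizing M with
  | zero => simp
  | succ N ih =>
    have hs1 : ∀ᶠ s : ℝ in 𝓝[>] 0, s < 1 := nhdsWithin_le_nhds (gt_mem_nhds one_pos)
    have ih' : ∀ k < N, g k = 0 := by
      refine ih (M := |M| + |g N|) ?_
      filter_upwards [h, self_mem_nhdsWithin, hs1] with s hs (hs0 : 0 < s) hs1
      rw [Finset.sum_range_succ] at hs
      have h1 : M * s ^ (N + 1) ≤ |M| * s ^ N :=
        mul_le_mul (le_abs_self M) (pow_le_pow_of_le_one hs0.le hs1.le (Nat.le_succ N))
          (by positivity) (abs_nonneg _)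
      have h2 : |g N * s ^ N| = |g N| * s ^ N := by rw [abs_mul, abs_of_pos (pow_pos hs0 N)]
      have h3 := abs_sub_abs_le_abs_sub (∑ k ∈ Finset.range N, g k * s ^ k) (-(g N * s ^ N))
      rw [abs_neg, sub_neg_eq_add] at h3
      linarith
    intro k hk
    rcases Nat.lt_succ_iff_lt_or_eq.1 hk with hk | rfl
    · exact ih' k hk
    have h4 : ∀ᶠ s : ℝ in 𝓝[>] 0, |g k| ≤ M * s := by
      filter_upwards [h, self_mem_nhdsWithin] with s hs (hs0 : 0 < s)
      rw [Finset.sum_range_succ, Finset.sum_eq_zero fun j hj => by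
        rw [ih' j (Finset.mem_range.1 hj), zero_mul], zero_add, abs_mul,
        abs_of_pos (pow_pos hs0 k), pow_succ, mul_comm (s ^ k), ← mul_assoc] at hs
      exact le_of_mul_le_mul_right hs (pow_pos hs0 k)
    have h5 : Tendsto (fun s : ℝ => M * s) (𝓝[>] 0) (𝓝 (M * 0)) :=
      ((continuous_const.mul continuous_id).tendsto 0).mono_left nhdsWithin_le_nhds
    rw [mul_zero] at h5
    exact abs_nonpos_iff.1 (ge_of_tendsto h5 h4)

variable {ι : Type*} [Fintype ι]

lemma homogPolyFun_eq_zero {N : ℕ} {P : ℕ → EuclideanSpace ℝ ι → ℝ}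
    (hP : ∀ k, P k ∈ homogPolyFun ι k) {M : ℝ}
    (h : ∀ᶠ x in 𝓝 (0 : EuclideanSpace ℝ ι), |∑ k ∈ Finset.range N, P k x| ≤ M * ‖x‖ ^ N) :
    ∀ k < N, ∀ x, P k x = 0 := by
  intro k hk x
  refine eq_zero_of_abs_sum_mul_pow_le (g := fun k => P k x) (M := M * ‖x‖ ^ N) ?_ k hk
  have ht : Tendsto (fun s : ℝ => s • x) (𝓝[>] 0) (𝓝 0) := by
    have : Continuous fun s : ℝ => s • x := by fun_prop
    simpa using (this.tendsto 0).mono_left nhdsWithin_le_nhds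
  filter_upwards [ht.eventually h, self_mem_nhdsWithin] with s hs (hs0 : 0 < s)
  simp only [homogPolyFun_smul (hP _), norm_smul, Real.norm_of_nonneg hs0.le] at hs
  simp only [mul_comm _ (s ^ _)]
  convert hs using 1
  ring

lemma homogPolyFun_eq_zero_of_le {N : ℕ} {Q : EuclideanSpace ℝ ι → ℝ}
    (hQ : Q ∈ homogPolyFun ι N) {M : ℝ}
    (h : ∀ᶠ x in 𝓝 (0 : EuclideanSpace ℝ ι), |Q x| ≤ M * ‖x‖ ^ (N + 1)) (x) : Q x = 0 := by
  have := homogPolyFun_eq_zero (N := N + 1) (M := M) (P := fun k => if k = N then Q else 0)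
    (fun k => by
      split_ifs with hk
      · exact hk ▸ hQ
      · exact (homogPolyFun ι k).zero_mem) (h.mono fun x hx => by
        rw [Finset.sum_range_succ, Finset.sum_eq_zero fun k hk => by
          simp [(Finset.mem_range.1 hk).ne]]
        simpa using hx) N (Nat.lt_succ_self N) x
  simpa using this

lemma kernelTerm_mem_homogPolyFun {V : Type*} [NormedAddCommGroup V] [InnerProductSpace ℝ V]
    (J : EuclideanSpace ℝ ι →ₗᵢ[ℝ] V) (m k : ℕ) (y : V) :
    (fun x => kernelTerm m k (J x) y) ∈ homogPolyFun ι k := by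
  classical
  have hu : (fun x => 2 * inner ℝ (J x) y / ‖y‖ ^ 2) ∈ homogPolyFun ι 1 := by
    have h := homogPolyFun_linear ((2 / ‖y‖ ^ 2) • (innerSL ℝ y).toLinearMap ∘ₗ J.toLinearMap)
    convert h using 2 with x
    simp only [LinearMap.smul_apply, LinearMap.comp_apply, smul_eq_mul]
    simp [real_inner_comm]
    ring
  have hv : (fun x => ‖J x‖ ^ 2 / ‖y‖ ^ 2) ∈ homogPolyFun ι 2 := by
    have h := homogPolyFun_const_mul (‖y‖ ^ 2)⁻¹ (homogPolyFun_norm_sq (ι := ι))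
    convert h using 2 with x
    rw [J.norm_map]
    ring
  refine homogPolyFun_const_mul _ ?_
  refine gegCoeff_induction (p := fun m k => (fun x => gegCoeff m k (2 * inner ℝ (J x) y / ‖y‖ ^ 2)
    (‖J x‖ ^ 2 / ‖y‖ ^ 2)) ∈ homogPolyFun ι k) ?_ ?_ ?_ ?_ ?_ m k
  · simpa [gegCoeff] using homogPolyFun_const 1
  · intro k; simp only [gegCoeff]; exact (homogPolyFun ι (k + 1)).zero_mem
  · intro m; simpa [gegCoeff] using homogPolyFun_const 1
  · intro m h1 h2
    simp only [gegCoeff, mul_one] at h2 ⊢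
    exact (homogPolyFun ι 1).add_mem hu h2
  · intro m k h1 h2 h3
    simp only [gegCoeff]
    have e1 := homogPolyFun_mul hu h1
    have e2 := homogPolyFun_mul hv h2
    rw [show 1 + (k + 1) = k + 2 by ring] at e1
    rw [show 2 + k = k + 2 by ring] at e2
    exact (homogPolyFun ι (k + 2)).add_mem ((homogPolyFun ι (k + 2)).sub_mem e1 e2) h3

end Vanishing

section Singular

variable {E : Type*} [NormedAddCommGroup E] [InnerProductSpace ℝ E]

lemma exists_norm_pow_mul_kernel_remainder_le {m : ℕ} (hm : 1 ≤ m) : ∃ C : ℝ, 0 ≤ C ∧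
    ∀ (N : ℕ) (x y : E), y ≠ 0 →
    ‖y‖ ^ N * |(‖x - y‖ ^ (2 * m))⁻¹ - ∑ k ∈ Finset.range (N + 1), kernelTerm m k x y| ≤
      C * 4 ^ N * ‖x‖ ^ (N + 1) * ((‖y‖ ^ (2 * m + 1))⁻¹ + (‖x - y‖ ^ (2 * m + 1))⁻¹) := by
  obtain ⟨C, hC0, hC⟩ := exists_kernel_remainder (E := E) m
  refine ⟨3 * C + 16 * (9 / 2) ^ m + 5, by positivity, fun N x y hy => ?_⟩
  have hy' : 0 < ‖y‖ := norm_pos_iff.2 hy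
  have hX : 0 ≤ ‖x‖ := norm_nonneg x
  set B := (‖y‖ ^ (2 * m + 1))⁻¹ with hB
  set D := (‖x - y‖ ^ (2 * m + 1))⁻¹ with hD
  have hB0 : 0 ≤ B := by positivity
  have hD0 : 0 ≤ D := by positivity
  rcases le_or_gt (4 * ‖x‖) ‖y‖ with h | h
  · calc _ ≤ ‖y‖ ^ N * (C * (3 * ‖x‖) ^ (N + 1) * (‖y‖ ^ (2 * m + (N + 1)))⁻¹) := by
          gcongr; exact hC (N + 1) x y hy h
      _ = 3 * C * 3 ^ N * ‖x‖ ^ (N + 1) * B := by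
          rw [hB, show 2 * m + (N + 1) = N + (2 * m + 1) by ring, pow_add ‖y‖ N, mul_inv, mul_pow]
          field_simp
          ring
      _ ≤ 3 * C * 4 ^ N * ‖x‖ ^ (N + 1) * (B + D) := by
          gcongr
          · norm_num
          · linarith
      _ ≤ _ := by
          gcongr
          have : (0 : ℝ) ≤ (9 / 2) ^ m := by positivity
          linarith
  · have h1 : (‖x - y‖ ^ (2 * m))⁻¹ ≤ 5 * ‖x‖ * D := by
      rcases eq_or_ne x y with rfl | hxy
      · rw [sub_self, norm_zero, zero_pow (by omega), inv_zero]
        positivity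
      · have h0 : 0 < ‖x - y‖ := norm_pos_iff.2 (sub_ne_zero.2 hxy)
        have h5 : ‖x - y‖ ≤ 5 * ‖x‖ := (norm_sub_le x y).trans (by linarith)
        calc (‖x - y‖ ^ (2 * m))⁻¹ = ‖x - y‖ * D := by rw [hD, pow_succ]; field_simp
          _ ≤ _ := by gcongr
    have h2 : ∀ k ∈ Finset.range (N + 1), ‖y‖ ^ N * |kernelTerm m k x y| ≤
        4 * (9 / 2) ^ m * 4 ^ N * ‖x‖ ^ (N + 1) * B * (3 / 4) ^ k := by
      intro k hk
      have hk : k ≤ N := Nat.lt_succ_iff.1 (Finset.mem_range.1 hk)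
      obtain ⟨j, rfl⟩ := Nat.exists_eq_add_of_le hk
      calc _ ≤ ‖y‖ ^ (k + j) * ((9 / 2) ^ m * (3 * ‖x‖) ^ k * (‖y‖ ^ (2 * m + k))⁻¹) := by
            gcongr; exact abs_kernelTerm_le m k x hy
        _ = (9 / 2) ^ m * 3 ^ k * ‖x‖ ^ k * ‖y‖ ^ (j + 1) * B := by
            rw [hB, pow_add, pow_add ‖y‖ _ k, pow_succ ‖y‖ (2 * m), pow_succ ‖y‖ j, mul_inv,
              mul_inv, mul_pow]
            field_simp
        _ ≤ (9 / 2) ^ m * 3 ^ k * ‖x‖ ^ k * (4 * ‖x‖) ^ (j + 1) * B := by gcongr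
        _ = _ := by
            have e : (3 : ℝ) ^ k = (3 / 4) ^ k * 4 ^ k := by rw [← mul_pow]; norm_num
            rw [e]
            ring
    have h3 : ∑ k ∈ Finset.range (N + 1), (3 / 4 : ℝ) ^ k ≤ 4 := by
      rw [geom_sum_eq (by norm_num)]
      have : (0 : ℝ) ≤ (3 / 4) ^ (N + 1) := by positivity
      rw [div_le_iff_of_neg (by norm_num)]
      linarith
    calc _ ≤ ‖y‖ ^ N * ((‖x - y‖ ^ (2 * m))⁻¹ + ∑ k ∈ Finset.range (N + 1), |kernelTerm m k x y|) := by
          gcongr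
          refine (abs_sub _ _).trans (add_le_add ?_ (Finset.abs_sum_le_sum_abs _ _))
          rw [abs_of_nonneg (by positivity)]
      _ = ‖y‖ ^ N * (‖x - y‖ ^ (2 * m))⁻¹ +
          ∑ k ∈ Finset.range (N + 1), ‖y‖ ^ N * |kernelTerm m k x y| := by
          rw [mul_add, Finset.mul_sum]
      _ ≤ (4 * ‖x‖) ^ N * (5 * ‖x‖ * D) + ∑ k ∈ Finset.range (N + 1),
          4 * (9 / 2) ^ m * 4 ^ N * ‖x‖ ^ (N + 1) * B * (3 / 4) ^ k := by
          refine add_le_add ?_ (Finset.sum_le_sum h2)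
          gcongr
      _ ≤ (4 * ‖x‖) ^ N * (5 * ‖x‖ * D) + 4 * (9 / 2) ^ m * 4 ^ N * ‖x‖ ^ (N + 1) * B * 4 := by
          rw [← Finset.mul_sum]
          gcongr
      _ = 4 ^ N * ‖x‖ ^ (N + 1) * (5 * D + 16 * (9 / 2) ^ m * B) := by
          rw [mul_pow]; ring
      _ ≤ 4 ^ N * ‖x‖ ^ (N + 1) * ((3 * C + 16 * (9 / 2) ^ m + 5) * (B + D)) := by
          gcongr
          have : (0 : ℝ) ≤ (9 / 2) ^ m := by positivity
          nlinarith [mul_nonneg hC0 hB0, mul_nonneg hC0 hD0, mul_nonneg this hD0]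
      _ = _ := by ring

end Singular

section Potential

variable {ι κ : Type*} [Fintype ι] [Fintype κ]

lemma exists_potential_expansion [Nonempty ι] {m : ℕ} (hm1 : 1 ≤ m)
    (hm : Fintype.card ι = 2 * m + 2)
    (J : EuclideanSpace ℝ κ →ₗᵢ[ℝ] EuclideanSpace ℝ ι) :
    ∃ K : ℝ, 0 ≤ K ∧ ∀ (N : ℕ) (H : ℝ) (h : EuclideanSpace ℝ ι → ℝ), Continuous h → 0 ≤ H →
      (∀ y, |h y| ≤ H * ‖y‖ ^ N) → (∀ y, 2 ≤ ‖y‖ → h y = 0) →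
      ∃ P : ℕ → EuclideanSpace ℝ κ → ℝ, (∀ k, P k ∈ homogPolyFun κ k) ∧
        (∀ x, ‖x‖ ≤ 1 / 4 → |(∫ y, h y * regKernel m 0 (J x - y)) -
          ∑ k ∈ Finset.range (N + 1), P k x| ≤ K * H * 4 ^ N * ‖x‖ ^ (N + 1)) ∧
        ∀ x, |P N x| ≤ K * H * 3 ^ N * ‖x‖ ^ N := by
  obtain ⟨C, hC0, hC⟩ := exists_norm_pow_mul_kernel_remainder_le
    (E := EuclideanSpace ℝ ι) hm1
  set p0 : EuclideanSpace ℝ ι → ℝ := (Metric.ball 0 3).indicator fun y => (‖y‖ ^ (2 * m))⁻¹ with hp0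
  set p1 : EuclideanSpace ℝ ι → ℝ :=
    (Metric.ball 0 3).indicator fun y => (‖y‖ ^ (2 * m + 1))⁻¹ with hp1
  have ip0 : Integrable p0 := (integrableOn_norm_pow_inv volume (by simp; omega) 3).integrable_indicator
    measurableSet_ball
  have ip1 : Integrable p1 := (integrableOn_norm_pow_inv volume (by simp; omega) 3).integrable_indicator
    measurableSet_ball
  have np0 : ∀ y, 0 ≤ p0 y := Set.indicator_nonneg fun y _ => by positivity
  have np1 : ∀ y, 0 ≤ p1 y := Set.indicator_nonneg fun y _ => by positivity
  have jp0 : 0 ≤ ∫ y, p0 y := integral_nonneg fun y => np0 y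
  have jp1 : 0 ≤ ∫ y, p1 y := integral_nonneg fun y => np1 y
  have hne : ∀ᵐ y : EuclideanSpace ℝ ι, y ≠ 0 := by simp [ae_iff]
  refine ⟨(9 / 2) ^ m * (∫ y, p0 y) + C * ((∫ y, p1 y) + ∫ y, p1 y), ?_, fun N H h hh hH hb hs => ?_⟩
  · positivity
  have hbd : ∀ k j, k + j = N → ∀ x y, y ≠ 0 → ‖h y * kernelTerm m k x y‖ ≤
      H * (9 / 2) ^ m * (3 * ‖x‖) ^ k * 2 ^ j * p0 y := by
    rintro k j rfl x y hy
    have hy' : 0 < ‖y‖ := norm_pos_iff.2 hy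
    rcases le_or_gt 2 ‖y‖ with h2 | h2
    · rw [hs y h2, zero_mul, norm_zero]
      have := np0 y
      positivity
    · rw [hp0, Set.indicator_of_mem (by simpa using h2.trans (by norm_num)), norm_mul,
        Real.norm_eq_abs, Real.norm_eq_abs]
      calc _ ≤ (H * ‖y‖ ^ (k + j)) * ((9 / 2) ^ m * (3 * ‖x‖) ^ k * (‖y‖ ^ (2 * m + k))⁻¹) := by
            gcongr
            · exact hb y
            · exact abs_kernelTerm_le m k x hy
        _ = H * (9 / 2) ^ m * (3 * ‖x‖) ^ k * ‖y‖ ^ j * (‖y‖ ^ (2 * m))⁻¹ := by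
            rw [pow_add, pow_add ‖y‖ _ k, mul_inv]
            field_simp
        _ ≤ _ := by gcongr
  have hint : ∀ k ≤ N, ∀ x, Integrable fun y => h y * kernelTerm m k x y := by
    intro k hk x
    obtain ⟨j, hj⟩ := Nat.exists_eq_add_of_le hk
    refine (ip0.const_mul _).mono' (hh.measurable.mul
      (measurable_kernelTerm m k x)).aestronglyMeasurable (hne.mono fun y hy => hbd k j hj.symm x y hy)
  refine ⟨fun k x => if k ≤ N then ∫ y, h y * kernelTerm m k (J x) y else 0, fun k => ?_,
    fun x hx => ?_, fun x => ?_⟩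
  · by_cases hk : k ≤ N
    · simp only [hk, if_true]
      exact integral_mem_of_finiteDimensional (homogPolyFun κ k)
        (g := fun y x => h y * kernelTerm m k (J x) y)
        (fun y => homogPolyFun_const_mul _ (kernelTerm_mem_homogPolyFun J m k y))
        (fun x => hint k hk (J x))
    · simp only [hk, if_false]
      exact (homogPolyFun κ k).zero_mem
  · have e1 : ∑ k ∈ Finset.range (N + 1), (if k ≤ N then ∫ y, h y * kernelTerm m k (J x) y else 0) =
        ∫ y, ∑ k ∈ Finset.range (N + 1), h y * kernelTerm m k (J x) y := by
      rw [integral_finsetSum _ fun k hk => hint k (Nat.lt_succ_iff.1 (Finset.mem_range.1 hk)) _]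
      exact Finset.sum_congr rfl fun k hk => if_pos (Nat.lt_succ_iff.1 (Finset.mem_range.1 hk))
    have hcs : HasCompactSupport h := HasCompactSupport.intro (isCompact_closedBall 0 2)
      fun y hy => hs y (by simpa using (not_le.1 (by simpa using hy)).le)
    rw [e1, ← integral_sub (integrable_mul_regKernel_sub (by omega) hh hcs (J x))
      (integrable_finsetSum _ fun k hk => hint k (Nat.lt_succ_iff.1 (Finset.mem_range.1 hk)) _)]
    have hb2 := norm_integral_le_of_norm_le (f := fun y => h y * regKernel m 0 (J x - y) -
      ∑ k ∈ Finset.range (N + 1), h y * kernelTerm m k (J x) y)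
      (((ip1.add (ip1.comp_sub_left (J x))).const_mul (H * (C * 4 ^ N * ‖x‖ ^ (N + 1)))))
      (hne.mono fun y hy => by
        rw [← Finset.mul_sum, ← mul_sub, regKernel_zero_eq, norm_mul, Real.norm_eq_abs,
          Real.norm_eq_abs]
        rcases le_or_gt 2 ‖y‖ with h2 | h2
        · rw [hs y h2, abs_zero, zero_mul]
          have := np1 y; have := np1 (J x - y)
          simp only [Pi.add_apply]
          positivity
        · have m1 : y ∈ Metric.ball (0 : EuclideanSpace ℝ ι) 3 := by
            simpa using h2.trans (by norm_num)
          have m2 : J x - y ∈ Metric.ball (0 : EuclideanSpace ℝ ι) 3 := by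
            have := norm_sub_le (J x) y
            rw [J.norm_map] at this
            rw [mem_ball_zero_iff]
            linarith
          simp only [Pi.add_apply, hp1, Set.indicator_of_mem m1, Set.indicator_of_mem m2]
          have := hC N (J x) y hy
          rw [J.norm_map] at this
          calc _ ≤ H * ‖y‖ ^ N * |(‖J x - y‖ ^ (2 * m))⁻¹ -
                ∑ k ∈ Finset.range (N + 1), kernelTerm m k (J x) y| := by gcongr; exact hb y
            _ ≤ _ := by
              rw [mul_assoc, mul_assoc H]
              gcongr)
    rw [integral_const_mul, integral_add' ip1 (ip1.comp_sub_left (J x)),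
      integral_sub_left_eq_self p1 volume (J x)] at hb2
    refine hb2.trans ?_
    have h1 : 0 ≤ (9 / 2) ^ m * (∫ y, p0 y) := by
      positivity
    calc _ = (C * ((∫ y, p1 y) + ∫ y, p1 y)) * H * 4 ^ N * ‖x‖ ^ (N + 1) := by ring
      _ ≤ _ := by gcongr; linarith
  · simp only [le_refl, if_true]
    have hb2 := norm_integral_le_of_norm_le (f := fun y => h y * kernelTerm m N (J x) y)
      (ip0.const_mul _) (hne.mono fun y hy => hbd N 0 rfl (J x) y hy)
    rw [integral_const_mul, J.norm_map] at hb2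
    refine hb2.trans ?_
    have h1 : 0 ≤ C * ((∫ y, p1 y) + ∫ y, p1 y) := by
      positivity
    calc _ = ((9 / 2) ^ m * (∫ y, p0 y)) * H * 3 ^ N * ‖x‖ ^ N := by rw [mul_pow]; ring
      _ ≤ _ := by gcongr; linarith

end Potential

/-- The degree `k` (in `x`) term in the expansion of `cutoffKernel m 0 χ x y`. -/
noncomputable def cutoffTerm {ι : Type*} [Fintype ι] [DecidableEq ι] (m : ℕ)
    (χ : EuclideanSpace ℝ ι → ℝ) : ℕ → EuclideanSpace ℝ ι → EuclideanSpace ℝ ι → ℝ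
  | 0, x, y => kernelTerm m 0 x y * eLap χ y - 4 * m * (fderiv ℝ χ y y * kernelTerm (m + 1) 0 x y)
  | k + 1, x, y => kernelTerm m (k + 1) x y * eLap χ y +
      4 * m * (fderiv ℝ χ y x * kernelTerm (m + 1) k x y -
        fderiv ℝ χ y y * kernelTerm (m + 1) (k + 1) x y)

section Cutoff

variable {ι κ : Type*} [Fintype ι] [DecidableEq ι]

lemma sum_cutoffTerm (m N : ℕ) (χ : EuclideanSpace ℝ ι → ℝ) (x y : EuclideanSpace ℝ ι) :
    ∑ k ∈ Finset.range (N + 1), cutoffTerm m χ k x y =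
      (∑ k ∈ Finset.range (N + 1), kernelTerm m k x y) * eLap χ y +
      4 * m * (fderiv ℝ χ y x * ∑ k ∈ Finset.range N, kernelTerm (m + 1) k x y -
        fderiv ℝ χ y y * ∑ k ∈ Finset.range (N + 1), kernelTerm (m + 1) k x y) := by
  induction N with
  | zero => simp [cutoffTerm]; ring
  | succ N ih =>
    rw [Finset.sum_range_succ, ih, Finset.sum_range_succ _ (N + 1),
      Finset.sum_range_succ _ (N + 1)]
    rw [Finset.sum_range_succ (fun k => kernelTerm (m + 1) k x y) N]
    simp only [cutoffTerm]
    ring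

lemma measurable_cutoffTerm (m k : ℕ) {χ : EuclideanSpace ℝ ι → ℝ} (hχ : ContDiff ℝ 2 χ)
    (x : EuclideanSpace ℝ ι) : Measurable (cutoffTerm m χ k x) := by
  have h1 := (continuous_eLap hχ).measurable
  have h2 : Measurable fun y => fderiv ℝ χ y x :=
    ((hχ.continuous_fderiv (by norm_num)).clm_apply continuous_const).measurable
  have h3 : Measurable fun y => fderiv ℝ χ y y :=
    ((hχ.continuous_fderiv (by norm_num)).clm_apply continuous_id).measurable
  have h4 := fun m k => measurable_kernelTerm m k x
  cases k with
  | zero => exact ((h4 m 0).mul h1).sub ((h3.mul (h4 _ _)).const_mul _)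
  | succ k =>
    exact ((h4 _ _).mul h1).add (((h2.mul (h4 _ _)).sub (h3.mul (h4 _ _))).const_mul _)

lemma cutoffTerm_mem_homogPolyFun [Fintype κ] (m k : ℕ) (χ : EuclideanSpace ℝ ι → ℝ)
    (J : EuclideanSpace ℝ κ →ₗᵢ[ℝ] EuclideanSpace ℝ ι) (y : EuclideanSpace ℝ ι) :
    (fun x => cutoffTerm m χ k (J x) y) ∈ homogPolyFun κ k := by
  classical
  have h := fun m k => kernelTerm_mem_homogPolyFun J m k y
  have h2 := homogPolyFun_linear ((fderiv ℝ χ y).toLinearMap ∘ₗ J.toLinearMap)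
  cases k with
  | zero =>
    refine (homogPolyFun κ 0).sub_mem ?_ (homogPolyFun_const_mul _ (homogPolyFun_const_mul _ (h _ _)))
    simp only [mul_comm _ (eLap χ y)]
    exact homogPolyFun_const_mul _ (h _ _)
  | succ k =>
    refine (homogPolyFun κ (k + 1)).add_mem ?_ (homogPolyFun_const_mul _
      ((homogPolyFun κ (k + 1)).sub_mem ?_ (homogPolyFun_const_mul _ (h _ _))))
    · simp only [mul_comm _ (eLap χ y)]
      exact homogPolyFun_const_mul _ (h _ _)
    · rw [add_comm k 1]
      exact homogPolyFun_mul h2 (h _ _)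

lemma abs_mul_add_mul_sub_le {c : ℝ} (hc : 0 ≤ c) (a l b p e q : ℝ) :
    |a * l + c * (b * p - e * q)| ≤ |a| * |l| + c * (|b| * |p| + |e| * |q|) := by
  refine (abs_add_le _ _).trans ?_
  rw [abs_mul, abs_mul c, ← abs_mul b, ← abs_mul e, abs_of_nonneg hc]
  gcongr
  exact abs_sub _ _

lemma abs_cutoffTerm_le (m k : ℕ) {χ : EuclideanSpace ℝ ι → ℝ} {B : ℝ} {x y : EuclideanSpace ℝ ι}
    (hD : ‖fderiv ℝ χ y‖ ≤ B) (hL : |eLap χ y| ≤ B) (hy1 : 1 ≤ ‖y‖) (hy2 : ‖y‖ ≤ 2) :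
    |cutoffTerm m χ k x y| ≤ (1 + 12 * m) * (9 / 2) ^ (m + 1) * B * (3 * ‖x‖) ^ k := by
  have hB : 0 ≤ B := (norm_nonneg _).trans hD
  have hy0 : y ≠ 0 := norm_pos_iff.1 (by linarith)
  have hk : ∀ m' ≤ m + 1, ∀ k, |kernelTerm m' k x y| ≤ (9 / 2) ^ (m + 1) * (3 * ‖x‖) ^ k := by
    intro m' hm' k
    refine (abs_kernelTerm_le m' k x hy0).trans ?_
    calc _ ≤ (9 / 2) ^ (m + 1) * (3 * ‖x‖) ^ k * 1 := by
          gcongr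
          · norm_num
          · exact inv_le_one_of_one_le₀ (one_le_pow₀ hy1)
      _ = _ := mul_one _
  have hDv : ∀ v, |fderiv ℝ χ y v| ≤ B * ‖v‖ := fun v =>
    ((fderiv ℝ χ y).le_opNorm v).trans (by gcongr)
  have hDy : |fderiv ℝ χ y y| ≤ B * 2 := (hDv y).trans (by gcongr)
  cases k with
  | zero =>
    have h1 := hk m (by omega) 0
    have h2 := hk (m + 1) le_rfl 0
    simp only [cutoffTerm]
    calc _ ≤ |kernelTerm m 0 x y| * |eLap χ y| +
          4 * m * (|fderiv ℝ χ y y| * |kernelTerm (m + 1) 0 x y|) := by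
          simpa [sub_eq_add_neg] using abs_mul_add_mul_sub_le (c := 4 * m) (by positivity)
            (kernelTerm m 0 x y) (eLap χ y) 0 0 (fderiv ℝ χ y y) (kernelTerm (m + 1) 0 x y)
      _ ≤ (9 / 2) ^ (m + 1) * (3 * ‖x‖) ^ 0 * B +
          4 * m * (B * 2 * ((9 / 2) ^ (m + 1) * (3 * ‖x‖) ^ 0)) := by gcongr
      _ = (1 + 8 * m) * (9 / 2) ^ (m + 1) * B * (3 * ‖x‖) ^ 0 := by ring
      _ ≤ _ := by gcongr; norm_num
  | succ k =>
    have h1 := hk m (by omega) (k + 1)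
    have h2 := hk (m + 1) le_rfl (k + 1)
    have h3 := hk (m + 1) le_rfl k
    simp only [cutoffTerm]
    calc _ ≤ |kernelTerm m (k + 1) x y| * |eLap χ y| +
          4 * m * (|fderiv ℝ χ y x| * |kernelTerm (m + 1) k x y| +
            |fderiv ℝ χ y y| * |kernelTerm (m + 1) (k + 1) x y|) :=
          abs_mul_add_mul_sub_le (by positivity) _ _ _ _ _ _
      _ ≤ (9 / 2) ^ (m + 1) * (3 * ‖x‖) ^ (k + 1) * B +
          4 * m * (B * ‖x‖ * ((9 / 2) ^ (m + 1) * (3 * ‖x‖) ^ k) +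
            B * 2 * ((9 / 2) ^ (m + 1) * (3 * ‖x‖) ^ (k + 1))) := by
          gcongr
          exact hDv x
      _ = (1 + (28 / 3) * m) * (9 / 2) ^ (m + 1) * B * (3 * ‖x‖) ^ (k + 1) := by ring
      _ ≤ _ := by gcongr; norm_num

lemma exists_cutoff_remainder (m : ℕ) : ∃ C : ℝ, 0 ≤ C ∧ ∀ (N : ℕ) (χ : EuclideanSpace ℝ ι → ℝ)
    (B : ℝ) (x y : EuclideanSpace ℝ ι), ‖fderiv ℝ χ y‖ ≤ B → |eLap χ y| ≤ B → 1 ≤ ‖y‖ → ‖y‖ ≤ 2 →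
    ‖x‖ ≤ 1 / 4 →
    |cutoffKernel m 0 χ x y - ∑ k ∈ Finset.range (N + 1), cutoffTerm m χ k x y| ≤
      C * B * (3 * ‖x‖) ^ (N + 1) := by
  obtain ⟨C₁, hC₁, h₁⟩ := exists_kernel_remainder (E := EuclideanSpace ℝ ι) m
  obtain ⟨C₂, hC₂, h₂⟩ := exists_kernel_remainder (E := EuclideanSpace ℝ ι) (m + 1)
  refine ⟨C₁ + 12 * m * C₂, by positivity, fun N χ B x y hD hL hy1 hy2 hx => ?_⟩
  have hB : 0 ≤ B := (norm_nonneg _).trans hD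
  have hy0 : y ≠ 0 := norm_pos_iff.1 (by linarith)
  have hxy : 4 * ‖x‖ ≤ ‖y‖ := by linarith
  have hDv : ∀ v, |fderiv ℝ χ y v| ≤ B * ‖v‖ := fun v =>
    ((fderiv ℝ χ y).le_opNorm v).trans (by gcongr)
  have hDy : |fderiv ℝ χ y y| ≤ B * 2 := (hDv y).trans (by gcongr)
  have hr : ∀ (C : ℝ) (p N : ℕ), 0 ≤ C → C * (3 * ‖x‖) ^ N * (‖y‖ ^ p)⁻¹ ≤ C * (3 * ‖x‖) ^ N := by
    intro C p N hC
    exact mul_le_of_le_one_right (by positivity) (inv_le_one_of_one_le₀ (one_le_pow₀ hy1))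
  have a1 := (h₁ (N + 1) x y hy0 hxy).trans (hr _ _ _ hC₁)
  have a2 := (h₂ N x y hy0 hxy).trans (hr _ _ _ hC₂)
  have a3 := (h₂ (N + 1) x y hy0 hxy).trans (hr _ _ _ hC₂)
  rw [sum_cutoffTerm, cutoffKernel, regKernel_zero_eq, regKernel_zero_eq, map_sub]
  set R₁ := (‖x - y‖ ^ (2 * m))⁻¹ - ∑ k ∈ Finset.range (N + 1), kernelTerm m k x y
  set R₂ := (‖x - y‖ ^ (2 * (m + 1)))⁻¹ - ∑ k ∈ Finset.range N, kernelTerm (m + 1) k x y with hR₂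
  set R₃ := (‖x - y‖ ^ (2 * (m + 1)))⁻¹ - ∑ k ∈ Finset.range (N + 1), kernelTerm (m + 1) k x y
    with hR₃
  calc _ = |R₁ * eLap χ y + 4 * m * (fderiv ℝ χ y x * R₂ - fderiv ℝ χ y y * R₃)| := by
        congr 1
        simp only [R₁, hR₂, hR₃]
        ring
    _ ≤ |R₁| * |eLap χ y| + 4 * m * (|fderiv ℝ χ y x| * |R₂| + |fderiv ℝ χ y y| * |R₃|) :=
        abs_mul_add_mul_sub_le (by positivity) _ _ _ _ _ _
    _ ≤ C₁ * (3 * ‖x‖) ^ (N + 1) * B + 4 * m * (B * ‖x‖ * (C₂ * (3 * ‖x‖) ^ N) +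
          B * 2 * (C₂ * (3 * ‖x‖) ^ (N + 1))) := by
        gcongr
        exact hDv x
    _ = (C₁ + 28 / 3 * m * C₂) * B * (3 * ‖x‖) ^ (N + 1) := by ring
    _ ≤ _ := by gcongr; norm_num

lemma fderiv_eLap_eq_zero_of_norm {χ : EuclideanSpace ℝ ι → ℝ}
    (h1 : ∀ y ∈ Metric.ball (0 : EuclideanSpace ℝ ι) 1, χ y = 1) (h2 : ∀ y, 2 ≤ ‖y‖ → χ y = 0)
    {y : EuclideanSpace ℝ ι} (hy : ¬ (1 ≤ ‖y‖ ∧ ‖y‖ ≤ 2)) : fderiv ℝ χ y = 0 ∧ eLap χ y = 0 := by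
  have : ∃ c, χ =ᶠ[𝓝 y] fun _ => c := by
    rcases lt_or_ge ‖y‖ 1 with h | h
    · exact ⟨1, by
        filter_upwards [Metric.isOpen_ball.mem_nhds (mem_ball_zero_iff.2 h)] with z hz using h1 z hz⟩
    · refine ⟨0, ?_⟩
      filter_upwards [(isOpen_lt continuous_const continuous_norm).mem_nhds
        (not_le.1 fun h' => hy ⟨h, h'⟩)] with z hz using h2 z (le_of_lt hz)
  obtain ⟨c, hc⟩ := this
  exact ⟨by simp [hc.fderiv_eq], by rw [hc.eLap_eq]; simp [eLap, secondDirDeriv]⟩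

lemma exists_cutoff_expansion [Fintype κ] (m : ℕ) {χ : EuclideanSpace ℝ ι → ℝ}
    (hχ : ContDiff ℝ 2 χ)
    (h1 : ∀ y ∈ Metric.ball (0 : EuclideanSpace ℝ ι) 1, χ y = 1) (h2 : ∀ y, 2 ≤ ‖y‖ → χ y = 0)
    (J : EuclideanSpace ℝ κ →ₗᵢ[ℝ] EuclideanSpace ℝ ι) :
    ∃ K : ℝ, 0 ≤ K ∧ ∀ (N : ℕ) (A : ℝ) (u : EuclideanSpace ℝ ι → ℝ), Continuous u → 0 ≤ A →
      (∀ y, ‖y‖ ≤ 2 → |u y| ≤ A) →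
      ∃ P : ℕ → EuclideanSpace ℝ κ → ℝ, (∀ k, P k ∈ homogPolyFun κ k) ∧
        (∀ x, ‖x‖ ≤ 1 / 4 → |(∫ y, u y * cutoffKernel m 0 χ (J x) y) -
          ∑ k ∈ Finset.range (N + 1), P k x| ≤ K * A * (3 * ‖x‖) ^ (N + 1)) ∧
        ∀ x, |P N x| ≤ K * A * (3 * ‖x‖) ^ N := by
  have cD := hχ.continuous_fderiv (by norm_num : (2 : WithTop ℕ∞) ≠ 0)
  have cL := continuous_eLap hχ
  obtain ⟨B₁, hB₁⟩ := (isCompact_closedBall (0 : EuclideanSpace ℝ ι) 2).exists_bound_of_continuousOn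
    cD.continuousOn
  obtain ⟨B₂, hB₂⟩ := (isCompact_closedBall (0 : EuclideanSpace ℝ ι) 2).exists_bound_of_continuousOn
    cL.continuousOn
  obtain ⟨C, hC, hrem⟩ := exists_cutoff_remainder (ι := ι) m
  set B := max (max B₁ B₂) 0
  have hD : ∀ y, ‖y‖ ≤ 2 → ‖fderiv ℝ χ y‖ ≤ B := fun y hy =>
    (hB₁ y (by simpa using hy)).trans ((le_max_left _ _).trans (le_max_left _ _))
  have hL : ∀ y, ‖y‖ ≤ 2 → |eLap χ y| ≤ B := fun y hy =>
    (hB₂ y (by simpa using hy)).trans ((le_max_right _ _).trans (le_max_left _ _))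
  have hB : 0 ≤ B := le_max_right _ _
  have hvan := fun y => fderiv_eLap_eq_zero_of_norm (y := y) h1 h2
  have hterm : ∀ y, ¬ (1 ≤ ‖y‖ ∧ ‖y‖ ≤ 2) → ∀ k x, cutoffTerm m χ k x y = 0 := by
    intro y hy k x
    obtain ⟨e1, e2⟩ := hvan y hy
    cases k <;> simp [cutoffTerm, e1, e2]
  set q : EuclideanSpace ℝ ι → ℝ := (Metric.ball 0 3).indicator fun _ => 1 with hq
  have iq : Integrable q := (integrable_indicator_iff measurableSet_ball).2
    (integrableOn_const measure_ball_lt_top.ne)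
  have nq : ∀ y, 0 ≤ q y := Set.indicator_nonneg fun y _ => zero_le_one
  have jq : 0 ≤ ∫ y, q y := integral_nonneg fun y => nq y
  set C' : ℝ := (1 + 12 * m) * (9 / 2) ^ (m + 1)
  refine ⟨C * B * (∫ y, q y) + C' * B * ∫ y, q y, by positivity, fun N A u hu hA hub => ?_⟩
  have hbd : ∀ k x y, ‖u y * cutoffTerm m χ k x y‖ ≤ A * (C' * B * (3 * ‖x‖) ^ k) * q y := by
    intro k x y
    by_cases hy : 1 ≤ ‖y‖ ∧ ‖y‖ ≤ 2
    · rw [hq, Set.indicator_of_mem (by simpa using hy.2.trans_lt (by norm_num)), mul_one, norm_mul]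
      exact mul_le_mul (hub y hy.2) (abs_cutoffTerm_le m k (hD y hy.2) (hL y hy.2) hy.1 hy.2)
        (abs_nonneg _) hA
    · rw [hterm y hy, mul_zero, norm_zero]
      have := nq y
      positivity
  have hint : ∀ k x, Integrable fun y => u y * cutoffTerm m χ k x y := fun k x =>
    (iq.const_mul _).mono' (hu.measurable.mul (measurable_cutoffTerm m k hχ x)).aestronglyMeasurable
      (Eventually.of_forall fun y => hbd k x y)
  refine ⟨fun k x => ∫ y, u y * cutoffTerm m χ k (J x) y, fun k => ?_, fun x hx => ?_, fun x => ?_⟩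
  · exact integral_mem_of_finiteDimensional (homogPolyFun κ k)
      (g := fun y x => u y * cutoffTerm m χ k (J x) y)
      (fun y => homogPolyFun_const_mul _ (cutoffTerm_mem_homogPolyFun m k χ J y))
      (fun x => hint k (J x))
  · rw [← integral_finsetSum _ fun k _ => hint k _]
    have hsum : Integrable fun y => ∑ k ∈ Finset.range (N + 1), u y * cutoffTerm m χ k (J x) y :=
      integrable_finsetSum _ fun k _ => hint k _
    have hbd2 : ∀ y, ‖u y * cutoffKernel m 0 χ (J x) y -
        ∑ k ∈ Finset.range (N + 1), u y * cutoffTerm m χ k (J x) y‖ ≤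
        A * (C * B * (3 * ‖x‖) ^ (N + 1)) * q y := by
      intro y
      rw [← Finset.mul_sum, ← mul_sub, norm_mul]
      by_cases hy : 1 ≤ ‖y‖ ∧ ‖y‖ ≤ 2
      · rw [hq, Set.indicator_of_mem (by simpa using hy.2.trans_lt (by norm_num)), mul_one]
        have := hrem N χ B (J x) y (hD y hy.2) (hL y hy.2) hy.1 hy.2 (by rwa [J.norm_map])
        rw [J.norm_map] at this
        exact mul_le_mul (hub y hy.2) this (abs_nonneg _) hA
      · obtain ⟨e1, e2⟩ := hvan y hy
        have := nq y
        simp only [cutoffKernel, hterm y hy, e1, e2]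
        simp
        positivity
    have hmeas : Measurable fun y => u y * cutoffKernel m 0 χ (J x) y := by
      have hk : ∀ k, Measurable fun y => regKernel k 0 (J x - y) := fun k =>
        (measurable_regKernel k _).comp (measurable_const.sub measurable_id)
      have hf : Measurable fun y => fderiv ℝ χ y (J x - y) := (cD.clm_apply (by fun_prop)).measurable
      exact hu.measurable.mul (((hf.const_mul _).mul (hk _)).add ((hk _).mul cL.measurable))
    have hdiff : Integrable fun y => u y * cutoffKernel m 0 χ (J x) y -
        ∑ k ∈ Finset.range (N + 1), u y * cutoffTerm m χ k (J x) y :=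
      (iq.const_mul _).mono' (hmeas.aestronglyMeasurable.sub hsum.aestronglyMeasurable)
        (Eventually.of_forall hbd2)
    have hfull : Integrable fun y => u y * cutoffKernel m 0 χ (J x) y :=
      (hdiff.add hsum).congr (Eventually.of_forall fun y => by simp)
    rw [← integral_sub hfull hsum]
    refine (norm_integral_le_of_norm_le (iq.const_mul _) (Eventually.of_forall hbd2)).trans ?_
    rw [integral_const_mul]
    calc _ = (C * B * ∫ y, q y) * A * (3 * ‖x‖) ^ (N + 1) := by ring
      _ ≤ _ := by
        gcongr
        exact le_add_of_nonneg_right (by positivity)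
  · refine (norm_integral_le_of_norm_le (iq.const_mul _) (Eventually.of_forall (hbd N (J x)))).trans ?_
    rw [integral_const_mul, J.norm_map]
    calc _ = (C' * B * ∫ y, q y) * A * (3 * ‖x‖) ^ N := by ring
      _ ≤ _ := by
        gcongr
        exact le_add_of_nonneg_left (by positivity)

end Cutoff

section Lift

variable {κ : Type*} [Fintype κ]

/-- The isometric inclusion `x ↦ (x, 0)`. -/
noncomputable def inclLeft (κ : Type*) [Fintype κ] :
    EuclideanSpace ℝ κ →ₗᵢ[ℝ] EuclideanSpace ℝ (κ ⊕ κ) where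
  toFun x := WithLp.toLp 2 (Sum.elim (fun i => x i) 0)
  map_add' x y := by ext (i | i) <;> simp
  map_smul' c x := by ext (i | i) <;> simp
  norm_map' x := by simp [EuclideanSpace.norm_eq]

/-- The projection `(x, z) ↦ x`. -/
noncomputable def projLeft (κ : Type*) [Fintype κ] :
    EuclideanSpace ℝ (κ ⊕ κ) →L[ℝ] EuclideanSpace ℝ κ :=
  LinearMap.toContinuousLinearMap
    { toFun := fun y => WithLp.toLp 2 fun i => y (Sum.inl i)
      map_add' := fun x y => by ext i; simp
      map_smul' := fun c x => by ext i; simp }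

lemma projLeft_apply (y : EuclideanSpace ℝ (κ ⊕ κ)) (i : κ) : projLeft κ y i = y (Sum.inl i) := rfl

lemma projLeft_inclLeft (x : EuclideanSpace ℝ κ) : projLeft κ (inclLeft κ x) = x := rfl

lemma norm_projLeft_le (y : EuclideanSpace ℝ (κ ⊕ κ)) : ‖projLeft κ y‖ ≤ ‖y‖ := by
  rw [EuclideanSpace.norm_eq, EuclideanSpace.norm_eq]
  refine Real.sqrt_le_sqrt ?_
  simp only [projLeft_apply, Fintype.sum_sum_type]
  exact le_add_of_nonneg_right (by positivity)

variable [DecidableEq κ]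

lemma eLap_comp_projLeft {f : EuclideanSpace ℝ κ → ℝ} (hf : ContDiff ℝ 2 f)
    (y : EuclideanSpace ℝ (κ ⊕ κ)) : eLap (fun y => f (projLeft κ y)) y = eLap f (projLeft κ y) := by
  have h : ∀ v, secondDirDeriv v (fun y => f (projLeft κ y)) y =
      secondDirDeriv (projLeft κ v) f (projLeft κ y) := fun v => by
    simpa using secondDirDeriv_comp_affine (f := f) (projLeft κ) 0 (x := y) hf.contDiffAt v
  have h1 : ∀ i : κ, projLeft κ (EuclideanSpace.single (Sum.inl i) 1) = EuclideanSpace.single i 1 := by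
    intro i; ext j; simp [projLeft_apply]
  have h2 : ∀ i : κ, projLeft κ (EuclideanSpace.single (Sum.inr i) 1) = 0 := by
    intro i; ext j; simp [projLeft_apply]
  simp only [eLap, Fintype.sum_sum_type, h, h1, h2, secondDirDeriv_zero]
  simp

lemma exists_homogeneous_expansion (hκ : 2 ≤ Fintype.card κ) : ∃ K : ℝ, 1 ≤ K ∧
    ∀ (N : ℕ) (A H : ℝ) (f : EuclideanSpace ℝ κ → ℝ), ContDiff ℝ 2 f → 0 ≤ A → 0 ≤ H →
      (∀ x, ‖x‖ ≤ 2 → |f x| ≤ A) → (∀ x, ‖x‖ ≤ 2 → |eLap f x| ≤ H * ‖x‖ ^ N) →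
      ∃ P : ℕ → EuclideanSpace ℝ κ → ℝ, (∀ k, P k ∈ homogPolyFun κ k) ∧
        (∀ x, ‖x‖ ≤ 1 / 4 → |f x - ∑ k ∈ Finset.range (N + 1), P k x| ≤
          K * (A + H) * 4 ^ N * ‖x‖ ^ (N + 1)) ∧
        ∀ x, |P N x| ≤ K * (A + H) * 3 ^ N * ‖x‖ ^ N := by
  obtain ⟨m, hm⟩ : ∃ m, Fintype.card κ = m + 1 := ⟨Fintype.card κ - 1, by omega⟩
  have hm1 : 1 ≤ m := by omega
  have hcard : Fintype.card (κ ⊕ κ) = 2 * m + 2 := by simp; omega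
  have : Nonempty (κ ⊕ κ) := Fintype.card_pos_iff.1 (by omega)
  let χ : ContDiffBump (0 : EuclideanSpace ℝ (κ ⊕ κ)) := ⟨1, 2, one_pos, one_lt_two⟩
  have hχ : ContDiff ℝ 2 χ := χ.contDiff
  have hχ1 : ∀ y ∈ Metric.ball (0 : EuclideanSpace ℝ (κ ⊕ κ)) 1, χ y = 1 := fun y hy =>
    χ.one_of_mem_closedBall (Metric.ball_subset_closedBall hy)
  have hχ2 : ∀ y, 2 ≤ ‖y‖ → χ y = 0 := fun y hy => χ.zero_of_le_dist (by simpa using hy)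
  obtain ⟨K₁, hK₁, h₁⟩ := exists_cutoff_expansion m hχ hχ1 hχ2 (inclLeft κ)
  obtain ⟨K₂, hK₂, h₂⟩ := exists_potential_expansion hm1 hcard (inclLeft κ)
  have hc := kernelConst_pos (ι := κ ⊕ κ) hm1 hcard
  set c := kernelConst (κ ⊕ κ) m
  refine ⟨1 + c⁻¹ * (3 * K₁ + K₂), le_add_of_nonneg_right (by positivity),
    fun N A H f hf hA hH hfA hfH => ?_⟩
  set u : EuclideanSpace ℝ (κ ⊕ κ) → ℝ := fun y => f (projLeft κ y) with hu
  have hu2 : ContDiff ℝ 2 u := hf.comp (projLeft κ).contDiff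
  have hLu : ∀ y, eLap u y = eLap f (projLeft κ y) := eLap_comp_projLeft hf
  obtain ⟨P, hP, hPx, hPN⟩ := h₁ N A u hu2.continuous hA
    fun y hy => hfA _ ((norm_projLeft_le y).trans hy)
  obtain ⟨Q, hQ, hQx, hQN⟩ := h₂ N H (fun y => χ y * eLap u y)
    (hχ.continuous.mul (continuous_eLap hu2)) hH (fun y => by
      rcases le_or_gt 2 ‖y‖ with hy | hy
      · rw [hχ2 y hy, zero_mul, abs_zero]; positivity
      · rw [abs_mul, abs_of_nonneg χ.nonneg, hLu]
        have h3 := hfH _ ((norm_projLeft_le y).trans hy.le)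
        calc _ ≤ 1 * (H * ‖projLeft κ y‖ ^ N) :=
              mul_le_mul χ.le_one h3 (abs_nonneg _) zero_le_one
          _ ≤ H * ‖y‖ ^ N := by
              rw [one_mul]
              gcongr
              exact norm_projLeft_le y)
    (fun y hy => by rw [hχ2 y hy, zero_mul])
  have hsum : ∀ (X : ℝ) (j : ℕ) (b : ℝ), 0 ≤ X → 3 ^ j ≤ b →
      c⁻¹ * (K₁ * A * X * 3 ^ j * 3 + K₂ * H * b * X) ≤
        (1 + c⁻¹ * (3 * K₁ + K₂)) * (A + H) * b * X := by
    intro X j b hX hb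
    have hb0 : 0 ≤ b := le_trans (by positivity) hb
    calc _ ≤ c⁻¹ * (K₁ * A * X * b * 3 + K₂ * H * b * X) := by gcongr
      _ = c⁻¹ * (3 * K₁ * A + K₂ * H) * (b * X) := by ring
      _ ≤ ((1 + c⁻¹ * (3 * K₁ + K₂)) * (A + H)) * (b * X) := by
        refine mul_le_mul_of_nonneg_right ?_ (by positivity)
        have e : (1 + c⁻¹ * (3 * K₁ + K₂)) * (A + H) = c⁻¹ * (3 * K₁ * A + K₂ * H) +
          (A + H + c⁻¹ * (3 * K₁ * H + K₂ * A)) := by ring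
        rw [e]
        exact le_add_of_nonneg_right (by positivity)
      _ = _ := by ring
  refine ⟨fun k x => c⁻¹ * (P k x - Q k x), fun k =>
    homogPolyFun_const_mul _ ((homogPolyFun κ k).sub_mem (hP k) (hQ k)), fun x hx => ?_, fun x => ?_⟩
  · have hrep := kernelConst_mul_eq hcard hu2 hχ χ.hasCompactSupport hχ1 (x := inclLeft κ x)
      (by rw [LinearIsometry.norm_map]; linarith)
    have e : f x = c⁻¹ * ((∫ y, u y * cutoffKernel m 0 χ (inclLeft κ x) y) -
        ∫ y, χ y * eLap u y * regKernel m 0 (inclLeft κ x - y)) := by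
      rw [← hrep, ← mul_assoc, inv_mul_cancel₀ hc.ne', one_mul, hu]
      simp only [projLeft_inclLeft]
    rw [e, ← Finset.mul_sum, ← mul_sub, Finset.sum_sub_distrib, abs_mul,
      abs_of_pos (inv_pos.2 hc), sub_sub_sub_comm]
    refine le_trans ?_ (hsum (‖x‖ ^ (N + 1)) N (4 ^ N) (by positivity)
      (by gcongr; norm_num))
    gcongr
    refine (abs_sub _ _).trans (add_le_add ((hPx x hx).trans_eq ?_) (hQx x hx))
    rw [mul_pow, pow_succ 3]; ring
  · rw [abs_mul, abs_of_pos (inv_pos.2 hc)]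
    refine le_trans ?_ (hsum (‖x‖ ^ N) N (3 ^ N) (by positivity) le_rfl)
    gcongr
    refine (abs_sub _ _).trans (add_le_add ((hPN x).trans ?_) (hQN x))
    rw [mul_pow]
    have : 0 ≤ K₁ * A * ‖x‖ ^ N * 3 ^ N := by positivity
    nlinarith

end Lift

section Leading

variable {κ : Type*} [Fintype κ] [DecidableEq κ]

lemma exists_leading_part (hκ : 2 ≤ Fintype.card κ) : ∃ K : ℝ, 1 ≤ K ∧
    ∀ (N : ℕ) (A H M : ℝ) (f : EuclideanSpace ℝ κ → ℝ), ContDiff ℝ 2 f → 0 ≤ A → 0 ≤ H →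
      (∀ x, ‖x‖ ≤ 2 → |f x| ≤ A) → (∀ x, ‖x‖ ≤ 2 → |eLap f x| ≤ H * ‖x‖ ^ N) →
      (∀ᶠ x in 𝓝 0, |f x| ≤ M * ‖x‖ ^ N) →
      ∃ Q ∈ homogPolyFun κ N, ∀ x, ‖x‖ ≤ 2 →
        |f x - Q x| ≤ 8 * K * (A + H) * 4 ^ N * ‖x‖ ^ (N + 1) := by
  obtain ⟨K, hK, h⟩ := exists_homogeneous_expansion hκ
  refine ⟨K, hK, fun N A H M f hf hA hH hfA hfH hM => ?_⟩
  obtain ⟨P, hP, hPx, hPN⟩ := h N A H f hf hA hH hfA hfH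
  have hball : ∀ᶠ x in 𝓝 (0 : EuclideanSpace ℝ κ), ‖x‖ < 1 / 4 := by
    filter_upwards [Metric.ball_mem_nhds (0 : EuclideanSpace ℝ κ) (by norm_num : (0:ℝ) < 1 / 4)]
      with x hx using by simpa using hx
  have hzero : ∀ k < N, ∀ x, P k x = 0 := by
    refine homogPolyFun_eq_zero hP (M := K * (A + H) * 4 ^ N + M + K * (A + H) * 3 ^ N) ?_
    filter_upwards [hM, hball] with x hx hx4
    have h1 := hPx x hx4.le
    rw [Finset.sum_range_succ] at h1
    have h2 : K * (A + H) * 4 ^ N * ‖x‖ ^ (N + 1) ≤ K * (A + H) * 4 ^ N * ‖x‖ ^ N := by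
      have : ‖x‖ ^ (N + 1) ≤ ‖x‖ ^ N :=
        pow_le_pow_of_le_one (norm_nonneg x) (by linarith) N.le_succ
      gcongr
    have h3 := hPN x
    rw [abs_le] at *
    constructor <;> linarith [h1.1, h1.2, h3.1, h3.2, hx.1, hx.2]
  refine ⟨P N, hP N, fun x hx => ?_⟩
  have h0 : 0 ≤ K * (A + H) * 4 ^ N * ‖x‖ ^ (N + 1) := by positivity
  rcases le_or_gt ‖x‖ (1 / 4) with hx4 | hx4
  · have h1 := hPx x hx4
    rw [Finset.sum_range_succ, Finset.sum_eq_zero fun k hk => hzero k (Finset.mem_range.1 hk) x,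
      zero_add] at h1
    linarith
  · have e1 : A ≤ 4 * (K * (A + H) * 4 ^ N * ‖x‖ ^ (N + 1)) := by
      have : 1 ≤ (4 * ‖x‖) ^ (N + 1) := one_le_pow₀ (by linarith)
      calc A = 1 * A * 1 := by ring
        _ ≤ K * (A + H) * (4 * ‖x‖) ^ (N + 1) := by gcongr; linarith
        _ = _ := by rw [mul_pow, pow_succ 4]; ring
    have e2 : |P N x| ≤ 4 * (K * (A + H) * 4 ^ N * ‖x‖ ^ (N + 1)) := by
      refine (hPN x).trans ?_
      calc K * (A + H) * 3 ^ N * ‖x‖ ^ N ≤ K * (A + H) * 4 ^ N * ‖x‖ ^ N * (4 * ‖x‖) := by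
            refine le_trans ?_ (le_mul_of_one_le_right (by positivity) (by linarith))
            gcongr; norm_num
        _ = _ := by ring
    linarith [abs_sub (f x) (P N x), hfA x hx]

lemma exists_leading_part_of_abs_eLap_le (hκ : 2 ≤ Fintype.card κ) {t : ℝ} (ht : 0 ≤ t) :
    ∃ K : ℝ, 1 ≤ K ∧ ∀ (N : ℕ) (A M : ℝ) (f : EuclideanSpace ℝ κ → ℝ), ContDiff ℝ 2 f → 0 ≤ A →
      (∀ x, ‖x‖ ≤ 2 → |f x| ≤ A) → (∀ x, ‖x‖ ≤ 2 → |eLap f x| ≤ t * |f x|) →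
      (∀ᶠ x in 𝓝 0, |f x| ≤ M * ‖x‖ ^ N) →
      ∃ Q ∈ homogPolyFun κ N, ∀ x, ‖x‖ ≤ 2 →
        |f x - Q x| ≤ A * (K ^ (N + 1) * 4 ^ (N + 1).choose 2) * ‖x‖ ^ (N + 1) := by
  obtain ⟨K, hK, h⟩ := exists_leading_part hκ
  have hK1 : 1 ≤ 8 * K * (1 + t) := by nlinarith
  refine ⟨8 * K * (1 + t), hK1, fun N A M f hf hA hfA hft hM => ?_⟩
  set c : ℕ → ℝ := fun n => (8 * K * (1 + t)) ^ n * 4 ^ n.choose 2 with hc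
  have hc1 : ∀ n, 1 ≤ c n := fun n =>
    one_le_mul_of_one_le_of_one_le (one_le_pow₀ hK1) (one_le_pow₀ (by norm_num))
  have step : ∀ n M, (∀ᶠ x in 𝓝 0, |f x| ≤ M * ‖x‖ ^ n) →
      (∀ x, ‖x‖ ≤ 2 → |f x| ≤ A * c n * ‖x‖ ^ n) → ∃ Q ∈ homogPolyFun κ n, ∀ x, ‖x‖ ≤ 2 →
        |f x - Q x| ≤ A * c (n + 1) * ‖x‖ ^ (n + 1) := by
    intro n M hM hb
    have hcn := hc1 n
    obtain ⟨Q, hQ, hQx⟩ := h n A (t * (A * c n)) M f hf hA (by positivity) hfA (fun x hx => by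
      rw [mul_assoc]
      exact (hft x hx).trans (mul_le_mul_of_nonneg_left (hb x hx) ht)) hM
    refine ⟨Q, hQ, fun x hx => (hQx x hx).trans ?_⟩
    refine mul_le_mul_of_nonneg_right ?_ (by positivity)
    have e : c (n + 1) = 8 * K * (1 + t) * c n * 4 ^ n := by
      simp only [hc]
      rw [Nat.choose_succ_succ' n 1, Nat.choose_one_right, pow_add, pow_succ]; ring
    rw [e]
    calc 8 * K * (A + t * (A * c n)) * 4 ^ n = 8 * K * A * (1 + t * c n) * 4 ^ n := by ring
      _ ≤ 8 * K * A * (c n + t * c n) * 4 ^ n := by gcongr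
      _ = _ := by ring
  have bound : ∀ n M, (∀ᶠ x in 𝓝 0, |f x| ≤ M * ‖x‖ ^ n) →
      ∀ x, ‖x‖ ≤ 2 → |f x| ≤ A * c n * ‖x‖ ^ n := by
    intro n
    induction n with
    | zero => intro M _ x hx; simpa [hc] using hfA x hx
    | succ n ih =>
      intro M hM
      have hM' : ∀ᶠ x in 𝓝 (0 : EuclideanSpace ℝ κ), |f x| ≤ |M| * ‖x‖ ^ n := by
        filter_upwards [hM, Metric.ball_mem_nhds (0 : EuclideanSpace ℝ κ) one_pos] with x hx hx1
        have hx1 : ‖x‖ ≤ 1 := by simpa using (Metric.mem_ball.1 hx1).le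
        have : ‖x‖ ^ (n + 1) ≤ ‖x‖ ^ n := pow_le_pow_of_le_one (norm_nonneg x) hx1 n.le_succ
        calc |f x| ≤ |M| * ‖x‖ ^ (n + 1) :=
              hx.trans (mul_le_mul_of_nonneg_right (le_abs_self M) (by positivity))
          _ ≤ _ := by gcongr
      obtain ⟨Q, hQ, hQx⟩ := step n |M| hM' (ih |M| hM')
      have hQ0 : ∀ x, Q x = 0 := by
        refine homogPolyFun_eq_zero_of_le hQ (M := A * c (n + 1) + M) ?_
        filter_upwards [hM, Metric.ball_mem_nhds (0 : EuclideanSpace ℝ κ) two_pos] with x hx hx2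
        have h1 := hQx x (by simpa using (Metric.mem_ball.1 hx2).le)
        rw [abs_le] at *
        constructor <;> linarith [h1.1, h1.2, hx.1, hx.2]
      exact fun x hx => by simpa [hQ0] using hQx x hx
  exact step N M hM (bound N M hM)

end Leading

section SupBound

variable {κ : Type*} [Fintype κ]

lemma measurePreserving_split : MeasurePreserving
    (fun y : EuclideanSpace ℝ (κ ⊕ κ) =>
      (projLeft κ y, (WithLp.toLp 2 fun i => y (Sum.inr i) : EuclideanSpace ℝ κ))) :=
  ((PiLp.volume_preserving_toLp κ).prod (PiLp.volume_preserving_toLp κ)).comp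
    ((volume_measurePreserving_sumPiEquivProdPi fun _ : κ ⊕ κ => ℝ).comp
      (PiLp.volume_preserving_ofLp (κ ⊕ κ)))

lemma exists_setIntegral_comp_projLeft_le : ∃ V : ℝ, 0 ≤ V ∧
    ∀ ψ : EuclideanSpace ℝ κ → ℝ, Continuous ψ →
      ∫ y in Metric.closedBall 0 2, |ψ (projLeft κ y)| ≤
        V * ∫ x in Metric.closedBall 0 2, |ψ x| := by
  set B := Metric.closedBall (0 : EuclideanSpace ℝ κ) 2
  have hBm : MeasurableSet B := measurableSet_closedBall
  set k : EuclideanSpace ℝ κ → ℝ := B.indicator 1 with hk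
  have hk0 : ∀ z, 0 ≤ k z := Set.indicator_nonneg fun _ _ => zero_le_one
  have ik : Integrable k :=
    (integrable_indicator_iff hBm).2 (integrableOn_const (isCompact_closedBall _ _).measure_lt_top.ne)
  refine ⟨∫ z, k z, integral_nonneg hk0, fun ψ hψ => ?_⟩
  set g : EuclideanSpace ℝ κ → ℝ := B.indicator fun x => |ψ x| with hg
  have hg0 : ∀ z, 0 ≤ g z := Set.indicator_nonneg fun _ _ => abs_nonneg _
  have ig : Integrable g := (integrable_indicator_iff hBm).2
    (hψ.abs.continuousOn.integrableOn_compact (isCompact_closedBall _ _))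
  have igk := ig.mul_prod ik
  have hmp := measurePreserving_split (κ := κ)
  have e : ∫ y : EuclideanSpace ℝ (κ ⊕ κ), g (projLeft κ y) *
      k (WithLp.toLp 2 fun i => y (Sum.inr i)) = (∫ z, k z) * ∫ x in B, |ψ x| := by
    rw [← integral_indicator hBm, mul_comm, ← integral_prod_mul g k]
    have h1 := integral_map hmp.aemeasurable (f := fun z => g z.1 * k z.2)
      (by rw [hmp.map_eq]; exact igk.aestronglyMeasurable)
    rw [hmp.map_eq] at h1
    exact h1.symm
  rw [← e, ← integral_indicator measurableSet_closedBall]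
  refine integral_mono_of_nonneg (Eventually.of_forall fun y =>
    Set.indicator_nonneg (fun _ _ => abs_nonneg _) y)
    (hmp.integrable_comp_of_integrable igk) (Eventually.of_forall fun y => ?_)
  by_cases hy : y ∈ Metric.closedBall (0 : EuclideanSpace ℝ (κ ⊕ κ)) 2
  swap
  · rw [Set.indicator_of_notMem hy]
    exact mul_nonneg (hg0 _) (hk0 _)
  have hy2 : ‖y‖ ≤ 2 := by simpa using hy
  have h1 : projLeft κ y ∈ B := by simpa [B] using (norm_projLeft_le y).trans hy2
  have h2 : (WithLp.toLp 2 fun i => y (Sum.inr i) : EuclideanSpace ℝ κ) ∈ B := by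
    refine mem_closedBall_zero_iff.2 (le_trans ?_ hy2)
    rw [EuclideanSpace.norm_eq, EuclideanSpace.norm_eq]
    refine Real.sqrt_le_sqrt ?_
    simp only [Fintype.sum_sum_type]
    exact le_add_of_nonneg_left (by positivity)
  simp [hg, hk, h1, h2, Set.indicator_of_mem hy]

end SupBound

section SupBound

variable {κ : Type*} [Fintype κ] [DecidableEq κ]

lemma exists_cutoffKernel_zero_bound {ι : Type*} [Fintype ι] [DecidableEq ι] (m : ℕ)
    {χ : EuclideanSpace ℝ ι → ℝ} (hχ : ContDiff ℝ 2 χ)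
    (h1 : ∀ y ∈ Metric.ball (0 : EuclideanSpace ℝ ι) 1, χ y = 1) (h2 : ∀ y, 2 ≤ ‖y‖ → χ y = 0) :
    ∃ D : ℝ, 0 ≤ D ∧ ∀ y, |cutoffKernel m 0 χ 0 y| ≤ (Metric.closedBall 0 2).indicator (fun _ => D) y := by
  obtain ⟨B₁, hB₁⟩ := (isCompact_closedBall (0 : EuclideanSpace ℝ ι) 2).exists_bound_of_continuousOn
    (hχ.continuous_fderiv (by norm_num)).continuousOn
  obtain ⟨B₂, hB₂⟩ := (isCompact_closedBall (0 : EuclideanSpace ℝ ι) 2).exists_bound_of_continuousOn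
    (continuous_eLap hχ).continuousOn
  have hB1 : 0 ≤ B₁ := (norm_nonneg _).trans (hB₁ 0 (by simp))
  have hB2 : 0 ≤ B₂ := (norm_nonneg _).trans (hB₂ 0 (by simp))
  refine ⟨4 * m * (B₁ * 2) + B₂, by positivity, fun y => ?_⟩
  by_cases hy : 1 ≤ ‖y‖ ∧ ‖y‖ ≤ 2
  · have hmem : y ∈ Metric.closedBall (0 : EuclideanSpace ℝ ι) 2 := by simpa using hy.2
    rw [Set.indicator_of_mem hmem]
    have hreg : ∀ k, |regKernel k 0 (0 - y)| ≤ 1 := fun k => by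
      rw [abs_of_nonneg (regKernel_nonneg k le_rfl _), regKernel_zero_eq, zero_sub, norm_neg]
      exact inv_le_one_of_one_le₀ (one_le_pow₀ hy.1)
    have hf : |fderiv ℝ χ y (0 - y)| ≤ B₁ * 2 := by
      refine ((fderiv ℝ χ y).le_opNorm _).trans ?_
      rw [zero_sub, norm_neg]
      exact mul_le_mul (hB₁ y hmem) hy.2 (norm_nonneg _) hB1
    refine (abs_add_le _ _).trans (add_le_add ?_ ?_)
    · rw [abs_mul, abs_mul, abs_of_nonneg (by positivity : (0 : ℝ) ≤ 4 * m)]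
      calc _ ≤ 4 * m * (B₁ * 2) * 1 := by gcongr; exact hreg _
        _ = _ := mul_one _
    · rw [abs_mul]
      calc _ ≤ 1 * B₂ := mul_le_mul (hreg m) (hB₂ y hmem) (abs_nonneg _) zero_le_one
        _ = _ := one_mul _
  · obtain ⟨e1, e2⟩ := fderiv_eLap_eq_zero_of_norm h1 h2 hy
    simp only [cutoffKernel, e1, e2]
    simpa using Set.indicator_nonneg (fun _ _ => by positivity) y

lemma exists_abs_apply_zero_le (hκ : 2 ≤ Fintype.card κ) : ∃ K : ℝ, 0 ≤ K ∧
    ∀ (H : ℝ) (ψ : EuclideanSpace ℝ κ → ℝ), ContDiff ℝ 2 ψ → 0 ≤ H →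
      (∀ x, ‖x‖ ≤ 2 → |eLap ψ x| ≤ H) →
      |ψ 0| ≤ K * ((∫ x in Metric.closedBall 0 2, |ψ x|) + H) := by
  obtain ⟨m, hm⟩ : ∃ m, Fintype.card κ = m + 1 := ⟨Fintype.card κ - 1, by omega⟩
  have hm1 : 1 ≤ m := by omega
  have hcard : Fintype.card (κ ⊕ κ) = 2 * m + 2 := by simp; omega
  have : Nonempty (κ ⊕ κ) := Fintype.card_pos_iff.1 (by omega)
  let χ : ContDiffBump (0 : EuclideanSpace ℝ (κ ⊕ κ)) := ⟨1, 2, one_pos, one_lt_two⟩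
  have hχ : ContDiff ℝ 2 χ := χ.contDiff
  have hχ1 : ∀ y ∈ Metric.ball (0 : EuclideanSpace ℝ (κ ⊕ κ)) 1, χ y = 1 := fun y hy =>
    χ.one_of_mem_closedBall (Metric.ball_subset_closedBall hy)
  have hχ2 : ∀ y, 2 ≤ ‖y‖ → χ y = 0 := fun y hy => χ.zero_of_le_dist (by simpa using hy)
  obtain ⟨D, hD, hDy⟩ := exists_cutoffKernel_zero_bound m hχ hχ1 hχ2
  obtain ⟨V, hV, hVψ⟩ := exists_setIntegral_comp_projLeft_le (κ := κ)
  have ik := integrable_mul_regKernel_sub (m := m) (by omega) hχ.continuous χ.hasCompactSupport 0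
  set I := ∫ y, χ y * regKernel m 0 (0 - y)
  have hI : 0 ≤ I := integral_nonneg fun y => mul_nonneg χ.nonneg (regKernel_nonneg m le_rfl _)
  have hc := kernelConst_pos (ι := κ ⊕ κ) hm1 hcard
  set c := kernelConst (κ ⊕ κ) m
  refine ⟨c⁻¹ * (D * V + I), by positivity, fun H ψ hψ hH hψH => ?_⟩
  set u : EuclideanSpace ℝ (κ ⊕ κ) → ℝ := fun y => ψ (projLeft κ y) with hu
  have hu2 : ContDiff ℝ 2 u := hψ.comp (projLeft κ).contDiff
  have hrep := kernelConst_mul_eq hcard hu2 hχ χ.hasCompactSupport hχ1 (x := 0) (by simp)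
  have hu0 : u 0 = ψ 0 := by simp [hu]
  rw [hu0] at hrep
  set J := ∫ x in Metric.closedBall 0 2, |ψ x|
  have hJ : 0 ≤ J := integral_nonneg fun x => abs_nonneg _
  have e1 : |∫ y, u y * cutoffKernel m 0 χ 0 y| ≤ D * V * J := by
    have iu : IntegrableOn (fun y => |u y|) (Metric.closedBall 0 2) :=
      hu2.continuous.abs.continuousOn.integrableOn_compact (isCompact_closedBall _ _)
    rw [← Real.norm_eq_abs]
    refine (norm_integral_le_of_norm_le
      (((integrable_indicator_iff measurableSet_closedBall).2 iu).const_mul D)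
      (Eventually.of_forall fun y => ?_)).trans ?_
    · rw [norm_mul, Real.norm_eq_abs, Real.norm_eq_abs]
      refine (mul_le_mul_of_nonneg_left (hDy y) (abs_nonneg _)).trans_eq ?_
      by_cases hy : y ∈ Metric.closedBall (0 : EuclideanSpace ℝ (κ ⊕ κ)) 2
      · rw [Set.indicator_of_mem hy, Set.indicator_of_mem hy, mul_comm]
      · rw [Set.indicator_of_notMem hy, Set.indicator_of_notMem hy, mul_zero, mul_zero]
    · rw [integral_const_mul, integral_indicator measurableSet_closedBall, mul_assoc]
      exact mul_le_mul_of_nonneg_left (hVψ ψ hψ.continuous) hD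
  have e2 : |∫ y, χ y * eLap u y * regKernel m 0 (0 - y)| ≤ I * H := by
    rw [← integral_mul_const, ← Real.norm_eq_abs]
    refine norm_integral_le_of_norm_le (ik.mul_const H) (Eventually.of_forall fun y => ?_)
    have hr := regKernel_nonneg m le_rfl (0 - y)
    rw [norm_mul, norm_mul, Real.norm_of_nonneg hr, Real.norm_of_nonneg χ.nonneg, Real.norm_eq_abs]
    rcases le_or_gt 2 ‖y‖ with hy | hy
    · simp [hχ2 y hy]
    · have := hψH _ ((norm_projLeft_le y).trans hy.le)
      rw [← eLap_comp_projLeft hψ] at this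
      calc _ ≤ χ y * H * regKernel m 0 (0 - y) := by
            gcongr
            exact χ.nonneg
        _ = _ := by ring
  have e3 : ψ 0 = c⁻¹ * ((∫ y, u y * cutoffKernel m 0 χ 0 y) -
      ∫ y, χ y * eLap u y * regKernel m 0 (0 - y)) := by
    rw [← hrep, ← mul_assoc, inv_mul_cancel₀ hc.ne', one_mul]
  rw [e3, abs_mul, abs_of_pos (inv_pos.2 hc), mul_assoc]
  refine mul_le_mul_of_nonneg_left ((abs_sub _ _).trans ((add_le_add e1 e2).trans ?_)) (by positivity)
  nlinarith [mul_nonneg hI hJ, mul_nonneg (mul_nonneg hD hV) hH]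

end SupBound

lemma sq_integral_abs_le {α : Type*} [MeasurableSpace α] {μ : Measure α} [IsFiniteMeasure μ]
    {f : α → ℝ} (h1 : Integrable f μ) (h2 : Integrable (fun x => f x ^ 2) μ) :
    (∫ x, |f x| ∂μ) ^ 2 ≤ μ.real Set.univ * ∫ x, f x ^ 2 ∂μ := by
  set v := μ.real Set.univ with hv
  set I := ∫ x, |f x| ∂μ with hI
  have hv0 : 0 ≤ v := measureReal_nonneg
  have h : 0 ≤ ∫ x, (v ^ 2 * f x ^ 2 - 2 * v * I * |f x| + I ^ 2) ∂μ := by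
    refine integral_nonneg fun x => ?_
    have : v ^ 2 * f x ^ 2 - 2 * v * I * |f x| + I ^ 2 = (v * |f x| - I) ^ 2 := by
      rw [sub_sq, mul_pow, sq_abs]; ring
    simp only [this]
    exact sq_nonneg _
  have i2 : Integrable (fun x => v ^ 2 * f x ^ 2 - 2 * v * I * |f x|) μ :=
    (h2.const_mul _).sub (h1.abs.const_mul _)
  rw [integral_add i2 (integrable_const _),
    integral_sub (h2.const_mul _) (h1.abs.const_mul _), integral_const_mul, integral_const_mul,
    integral_const, smul_eq_mul, ← hv, ← hI] at h
  rcases hv0.eq_or_lt with hv0 | hv0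
  · have : μ = 0 := Measure.measure_univ_eq_zero.1
      ((measureReal_eq_zero_iff).1 (hv.symm.trans hv0.symm))
    simp [hI, this]
  · nlinarith

section SupBound

variable {κ : Type*} [Fintype κ] [DecidableEq κ]

lemma exists_sup_le_setIntegral (hκ : 2 ≤ Fintype.card κ) {t : ℝ} (ht : 0 ≤ t) : ∃ K : ℝ, 0 ≤ K ∧
    ∀ f : EuclideanSpace ℝ κ → ℝ, ContDiff ℝ 2 f →
      (∀ x, ‖x‖ < 5 / 2 → |eLap f x| ≤ t * |f x|) →
      ∀ x, ‖x‖ ≤ 2 → |f x| ≤ K * ∫ x in Metric.closedBall 0 (5 / 2), |f x| := by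
  obtain ⟨K, hK, h⟩ := exists_abs_apply_zero_le hκ
  set d := Fintype.card κ
  set S := K * t * 2 ^ d with hS
  have hS0 : 0 ≤ S := by positivity
  set θ := (4 * (1 + S))⁻¹ with hθ
  have hθ0 : 0 < θ := by positivity
  have hθ4 : θ ≤ 1 / 4 := by
    rw [hθ, one_div]
    exact inv_anti₀ (by norm_num) (by linarith)
  have hθS : S * θ ≤ 1 / 4 := by
    rw [hθ, ← div_eq_mul_inv, div_le_iff₀ (by positivity)]
    linarith
  refine ⟨2 ^ d * (2 * K * (θ ^ d)⁻¹), by positivity, fun f hf hft x hx => ?_⟩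
  set B := Metric.closedBall (0 : EuclideanSpace ℝ κ) (5 / 2) with hB
  have hBm : MeasurableSet B := measurableSet_closedBall
  set I := ∫ x in B, |f x| with hI
  have hI0 : 0 ≤ I := integral_nonneg fun _ => abs_nonneg _
  obtain ⟨a, ha, hmax⟩ := (isCompact_closedBall (0 : EuclideanSpace ℝ κ) (5 / 2)).exists_isMaxOn
    ⟨0, by simp; norm_num⟩ (f := fun x => (5 / 2 - ‖x‖) ^ d * |f x|) (by
      have := hf.continuous
      fun_prop)
  have hmax' : ∀ y, ‖y‖ ≤ 5 / 2 → (5 / 2 - ‖y‖) ^ d * |f y| ≤ (5 / 2 - ‖a‖) ^ d * |f a| :=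
    fun y hy => hmax (mem_closedBall_zero_iff.2 hy)
  have ha : ‖a‖ ≤ 5 / 2 := mem_closedBall_zero_iff.1 ha
  set σ := 5 / 2 - ‖a‖ with hσ
  have key : σ ^ d * |f a| ≤ 2 * K * (θ ^ d)⁻¹ * I := by
    rcases (sub_nonneg.2 ha).eq_or_lt with h0 | hσ0
    · rw [hσ, ← h0, zero_pow (by omega), zero_mul]
      positivity
    rw [← hσ] at hσ0
    set ρ := θ * σ with hρ
    have hρ0 : 0 < ρ := by positivity
    have hnorm : ∀ y : EuclideanSpace ℝ κ, ‖y‖ ≤ 2 → ‖a + ρ • y‖ ≤ 5 / 2 - σ / 2 := by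
      intro y hy
      refine (norm_add_le _ _).trans ?_
      rw [norm_smul, Real.norm_of_nonneg hρ0.le]
      have : ρ * ‖y‖ ≤ (1 / 4 * σ) * 2 := by
        rw [hρ]; gcongr
      linarith
    have hfy : ∀ y : EuclideanSpace ℝ κ, ‖y‖ ≤ 2 → |f (a + ρ • y)| ≤ 2 ^ d * |f a| := by
      intro y hy
      have h1 := hmax' (a + ρ • y) (by linarith [hnorm y hy])
      have h2 : (σ / 2) ^ d * |f (a + ρ • y)| ≤ σ ^ d * |f a| := by
        refine le_trans ?_ h1
        gcongr
        linarith [hnorm y hy]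
      rw [div_pow, div_mul_eq_mul_div, div_le_iff₀ (by positivity), mul_assoc] at h2
      rw [mul_comm (2 ^ d)]
      exact le_of_mul_le_mul_left h2 (by positivity)
    have hψ : ContDiff ℝ 2 fun y => f (a + ρ • y) := by fun_prop
    have h1 := h (ρ ^ 2 * (t * (2 ^ d * |f a|))) (fun y => f (a + ρ • y)) hψ (by positivity)
      (fun y hy => by
        rw [eLap_comp_homothety a ρ hf.contDiffAt, abs_mul, abs_of_nonneg (by positivity)]
        refine mul_le_mul_of_nonneg_left ((hft _ ?_).trans ?_) (by positivity)
        · linarith [hnorm y hy]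
        · exact mul_le_mul_of_nonneg_left (hfy y hy) ht)
    rw [smul_zero, add_zero] at h1
    have hsmall : K * (ρ ^ 2 * (t * (2 ^ d * |f a|))) ≤ 1 / 2 * |f a| := by
      have : K * (ρ ^ 2 * (t * (2 ^ d * |f a|))) = S * θ * θ * σ ^ 2 * |f a| := by
        rw [hρ, hS]; ring
      rw [this]
      have hσ1 : σ ≤ 5 / 2 := by linarith [norm_nonneg a]
      gcongr
      calc S * θ * θ * σ ^ 2 ≤ 1 / 4 * (1 / 4) * (5 / 2) ^ 2 := by gcongr
        _ ≤ 1 / 2 := by norm_num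
    set g : EuclideanSpace ℝ κ → ℝ := B.indicator fun x => |f x| with hg
    have ig : Integrable g := (integrable_indicator_iff hBm).2
      (hf.continuous.abs.continuousOn.integrableOn_compact (isCompact_closedBall _ _))
    have hint : ∫ y in Metric.closedBall 0 2, |f (a + ρ • y)| ≤ (ρ ^ d)⁻¹ * I := by
      have e : ∫ y, g (a + ρ • y) = (ρ ^ d)⁻¹ * I := by
        rw [Measure.integral_comp_smul volume (fun y => g (a + y)) ρ, integral_add_left_eq_self,
          integral_indicator hBm, finrank_euclideanSpace, smul_eq_mul,
          abs_of_nonneg (by positivity)]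
      rw [← e, ← integral_indicator measurableSet_closedBall]
      refine integral_mono_of_nonneg (Eventually.of_forall fun y =>
        Set.indicator_nonneg (fun _ _ => abs_nonneg _) y)
        ((ig.comp_add_left a).comp_smul hρ0.ne') (Eventually.of_forall fun y => ?_)
      have hgn : ∀ z, 0 ≤ g z := Set.indicator_nonneg fun _ _ => abs_nonneg _
      refine Set.indicator_apply_le' (fun hy => ?_) fun _ => hgn _
      have hmem : a + ρ • y ∈ B := mem_closedBall_zero_iff.2
        (by linarith [hnorm y (mem_closedBall_zero_iff.1 hy)])
      exact (Set.indicator_of_mem hmem fun x => |f x|).ge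
    have h2 : |f a| ≤ 2 * K * ((ρ ^ d)⁻¹ * I) := by
      have := mul_le_mul_of_nonneg_left hint hK
      rw [mul_add] at h1
      linarith
    calc σ ^ d * |f a| ≤ σ ^ d * (2 * K * ((ρ ^ d)⁻¹ * I)) := by gcongr
      _ = 2 * K * (θ ^ d)⁻¹ * I := by
        rw [hρ, mul_pow]
        field_simp
  have h3 : (1 / 2) ^ d * |f x| ≤ σ ^ d * |f a| := by
    refine le_trans ?_ (hmax' x (by linarith))
    gcongr
    linarith
  have h4 := h3.trans key
  rw [div_pow, one_pow, div_mul_eq_mul_div, one_mul, div_le_iff₀ (by positivity)] at h4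
  linarith

lemma exists_sup_le_sqrt_setIntegral_sq (hκ : 2 ≤ Fintype.card κ) {t : ℝ} (ht : 0 ≤ t) :
    ∃ K : ℝ, 0 ≤ K ∧ ∀ f : EuclideanSpace ℝ κ → ℝ, ContDiff ℝ 2 f →
      (∀ x, ‖x‖ < 5 / 2 → |eLap f x| ≤ t * |f x|) →
      ∀ x, ‖x‖ ≤ 2 → |f x| ≤ K * √(∫ x in Metric.closedBall 0 (5 / 2), f x ^ 2) := by
  obtain ⟨K, hK, h⟩ := exists_sup_le_setIntegral hκ ht
  set v := volume.real (Metric.closedBall (0 : EuclideanSpace ℝ κ) (5 / 2))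
  refine ⟨K * √v, by positivity, fun f hf hft x hx => (h f hf hft x hx).trans ?_⟩
  rw [mul_assoc]
  refine mul_le_mul_of_nonneg_left ?_ hK
  have hfin : IsFiniteMeasure (volume.restrict (Metric.closedBall (0 : EuclideanSpace ℝ κ) (5 / 2))) :=
    isFiniteMeasure_restrict.2 (isCompact_closedBall _ _).measure_lt_top.ne
  rw [← Real.sqrt_mul measureReal_nonneg]
  refine Real.le_sqrt_of_sq_le ((sq_integral_abs_le ?_ ?_).trans_eq ?_)
  · exact hf.continuous.continuousOn.integrableOn_compact (isCompact_closedBall _ _)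
  · exact (hf.continuous.pow 2).continuousOn.integrableOn_compact (isCompact_closedBall _ _)
  · simp

end SupBound

section Harmonic

variable {ι : Type*} [Fintype ι]

lemma MvPolynomial.contDiff_eval_euclideanSpace (P : MvPolynomial ι ℝ) {n : WithTop ℕ∞} :
    ContDiff ℝ n fun x : EuclideanSpace ℝ ι => MvPolynomial.eval (fun i => x i) P := by
  induction P using MvPolynomial.induction_on with
  | C a => simpa using contDiff_const
  | add p q hp hq => simpa using hp.add hq
  | mul_X p i hp =>
    simp only [map_mul, MvPolynomial.eval_X]
    exact hp.mul (by fun_prop)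

lemma homogPolyFun_contDiff {k : ℕ} {f : EuclideanSpace ℝ ι → ℝ} (hf : f ∈ homogPolyFun ι k)
    {n : WithTop ℕ∞} : ContDiff ℝ n f := by
  obtain ⟨P, -, hP⟩ := hf
  rw [funext hP]
  exact P.contDiff_eval_euclideanSpace

variable [DecidableEq ι]

lemma MvPolynomial.fderiv_eval_single (P : MvPolynomial ι ℝ) (i : ι) (x : EuclideanSpace ℝ ι) :
    fderiv ℝ (fun x : EuclideanSpace ℝ ι => MvPolynomial.eval (fun i => x i) P) x
      (EuclideanSpace.single i 1) = MvPolynomial.eval (fun i => x i) (MvPolynomial.pderiv i P) := by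
  have hd : ∀ p : MvPolynomial ι ℝ, DifferentiableAt ℝ
      (fun x : EuclideanSpace ℝ ι => MvPolynomial.eval (fun i => x i) p) x := fun p =>
    (p.contDiff_eval_euclideanSpace (n := 1)).differentiable (by norm_num) x
  induction P using MvPolynomial.induction_on with
  | C a => simp
  | add p q hp hq =>
    simp only [map_add]
    rw [fderiv_fun_add (hd p) (hd q), add_apply, hp, hq]
  | mul_X p j hp =>
    have hj : HasFDerivAt (fun x : EuclideanSpace ℝ ι => x j)
        (EuclideanSpace.proj j : EuclideanSpace ℝ ι →L[ℝ] ℝ) x :=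
      (EuclideanSpace.proj j : EuclideanSpace ℝ ι →L[ℝ] ℝ).hasFDerivAt
    simp only [map_mul, MvPolynomial.eval_X]
    rw [fderiv_fun_mul (hd p) hj.differentiableAt, hj.fderiv]
    simp [hp, MvPolynomial.pderiv_X, Pi.single_apply, mul_comm]
    split_ifs <;> simp

lemma MvPolynomial.eLap_eval (P : MvPolynomial ι ℝ) (x : EuclideanSpace ℝ ι) :
    eLap (fun x : EuclideanSpace ℝ ι => MvPolynomial.eval (fun i => x i) P) x =
      MvPolynomial.eval (fun i => x i)
        (∑ j, MvPolynomial.pderiv j (MvPolynomial.pderiv j P)) := by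
  simp only [eLap, secondDirDeriv, MvPolynomial.fderiv_eval_single, map_sum]

lemma eLap_eq_zero_of_isLeading {N : ℕ} {t M : ℝ} (ht : 0 ≤ t) {f Q : EuclideanSpace ℝ ι → ℝ}
    (hf : ContDiff ℝ 2 f) (hft : ∀ᶠ x in 𝓝 0, |eLap f x| ≤ t * |f x|)
    (hQ : Q ∈ homogPolyFun ι N) (hM : ∀ᶠ x in 𝓝 0, |f x - Q x| ≤ M * ‖x‖ ^ (N + 1)) (x) :
    eLap Q x = 0 := by
  have hQc : ContDiff ℝ 2 Q := homogPolyFun_contDiff hQ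
  have hLQ := continuous_eLap hQc
  suffices h : ∀ η : EuclideanSpace ℝ ι → ℝ, ContDiff ℝ 2 η → HasCompactSupport η →
      ∫ y, Q y * eLap η y = 0 by
    have hae : eLap Q =ᵐ[volume] fun _ => 0 :=
      ae_eq_zero_of_integral_contDiff_smul_eq_zero hLQ.locallyIntegrable fun η hη hc => by
        have hη2 : ContDiff ℝ 2 η := contDiff_infty.1 hη 2
        simpa [integral_mul_eLap_comm hQc hη2 hc] using h η hη2 hc
    exact congrFun ((Continuous.ae_eq_iff_eq volume hLQ continuous_const).1 hae) x
  intro η hη hc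
  have cL := continuous_eLap hη
  obtain ⟨R, hR⟩ := hc.isCompact.isBounded.subset_closedBall 0
  have hηz : ∀ y, R < ‖y‖ → η y = 0 ∧ eLap η y = 0 := by
    intro y hy
    have hy' : y ∉ tsupport η := fun h => absurd (mem_closedBall_zero_iff.1 (hR h)) (not_le.2 hy)
    have he : η =ᶠ[𝓝 y] fun _ => 0 := notMem_tsupport_iff_eventuallyEq.1 hy'
    exact ⟨he.eq_of_nhds, by rw [he.eLap_eq]; simp [eLap, secondDirDeriv]⟩
  have hcL : HasCompactSupport (eLap η) :=
    HasCompactSupport.intro (isCompact_closedBall 0 R) fun y hy =>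
      (hηz y (not_le.1 fun h => hy (mem_closedBall_zero_iff.2 h))).2
  obtain ⟨δ, hδ, hball⟩ := Metric.eventually_nhds_iff_ball.1 (hft.and hM)
  set b := |M| * |R| ^ (N + 1) with hb
  have hb0 : 0 ≤ b := by positivity
  have i1 : Integrable fun y => b * |eLap η y| := (cL.integrable_of_hasCompactSupport hcL).abs.const_mul b
  have i2 : Integrable fun y => t * (|Q y| + b) * |η y| :=
    Continuous.integrable_of_hasCompactSupport
      (by have := hQc.continuous; have := hη.continuous; fun_prop) hc.norm.mul_left
  have key : ∀ᶠ s : ℝ in 𝓝[>] 0, |∫ y, Q y * eLap η y| ≤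
      s * ((∫ y, b * |eLap η y|) + ∫ y, t * (|Q y| + b) * |η y|) := by
    have hs1 : ∀ᶠ s : ℝ in 𝓝[>] 0, s < min 1 (δ / (|R| + 1)) :=
      nhdsWithin_le_nhds (gt_mem_nhds (by positivity))
    filter_upwards [self_mem_nhdsWithin, hs1] with s (hs : 0 < s) hs1
    have hs1' : s ≤ 1 := (hs1.trans_le (min_le_left _ _)).le
    have hsδ : s * (|R| + 1) < δ := (lt_div_iff₀ (by positivity)).1 (hs1.trans_le (min_le_right _ _))
    have hsy : ∀ y : EuclideanSpace ℝ ι, ‖y‖ ≤ R → |eLap f (s • y)| ≤ s ^ N * (t * (|Q y| + b)) ∧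
        |f (s • y) - Q (s • y)| ≤ s ^ (N + 1) * b := by
      intro y hy
      have hyR : ‖y‖ ≤ |R| := hy.trans (le_abs_self R)
      have hmem : s • y ∈ Metric.ball (0 : EuclideanSpace ℝ ι) δ := by
        rw [mem_ball_zero_iff, norm_smul, Real.norm_of_nonneg hs.le]
        refine lt_of_le_of_lt ?_ hsδ
        gcongr
        linarith
      obtain ⟨e1, e2⟩ := hball _ hmem
      have e3 : |f (s • y) - Q (s • y)| ≤ s ^ (N + 1) * b := by
        refine e2.trans ?_
        rw [norm_smul, Real.norm_of_nonneg hs.le, mul_pow]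
        calc M * (s ^ (N + 1) * ‖y‖ ^ (N + 1)) ≤ |M| * (s ^ (N + 1) * |R| ^ (N + 1)) := by
              gcongr
              exact le_abs_self M
          _ = _ := by rw [hb]; ring
      refine ⟨e1.trans ?_, e3⟩
      rw [homogPolyFun_smul hQ] at e3
      have e4 : |f (s • y)| ≤ s ^ N * (|Q y| + b) := by
        have h1 := abs_add_le (f (s • y) - s ^ N * Q y) (s ^ N * Q y)
        rw [sub_add_cancel, abs_mul (s ^ N), abs_of_nonneg (by positivity : 0 ≤ s ^ N)] at h1
        have h2 : s ^ (N + 1) * b ≤ s ^ N * b := by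
          gcongr ?_ * _
          exact pow_le_pow_of_le_one hs.le hs1' N.le_succ
        linarith
      calc _ ≤ t * (s ^ N * (|Q y| + b)) := by gcongr
        _ = _ := by ring
    have hfs : ContDiff ℝ 2 fun y => f (s • y) := by fun_prop
    have hom : ∀ y, eLap (fun y => f (s • y)) y = s ^ 2 * eLap f (s • y) := fun y => by
      simpa using eLap_comp_homothety 0 s (x := y) hf.contDiffAt
    have hid := integral_mul_eLap_comm hfs hη hc
    simp only [hom] at hid
    have j1 : Integrable fun y => f (s • y) * eLap η y :=
      (hfs.continuous.mul cL).integrable_of_hasCompactSupport hcL.mul_left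
    have j2 : Integrable fun y => (f (s • y) - Q (s • y)) * eLap η y :=
      Continuous.integrable_of_hasCompactSupport
        ((hfs.continuous.sub (by have := hQc.continuous; fun_prop)).mul cL) hcL.mul_left
    have e : s ^ N * ∫ y, Q y * eLap η y = (∫ y, η y * (s ^ 2 * eLap f (s • y))) -
        ∫ y, (f (s • y) - Q (s • y)) * eLap η y := by
      rw [← hid, ← integral_sub j1 j2, ← integral_const_mul]
      refine integral_congr_ae (Eventually.of_forall fun y => ?_)
      simp only [homogPolyFun_smul hQ]
      ring
    have e1 : |∫ y, η y * (s ^ 2 * eLap f (s • y))| ≤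
        s ^ (N + 1) * ∫ y, t * (|Q y| + b) * |η y| := by
      rw [← integral_const_mul, ← Real.norm_eq_abs]
      refine norm_integral_le_of_norm_le (i2.const_mul _) (Eventually.of_forall fun y => ?_)
      rcases le_or_gt ‖y‖ R with hy | hy
      · rw [Real.norm_eq_abs, abs_mul, abs_mul, abs_of_nonneg (sq_nonneg s)]
        calc |η y| * (s ^ 2 * |eLap f (s • y)|) ≤
            |η y| * (s ^ 1 * (s ^ N * (t * (|Q y| + b)))) := by
              have := (hsy y hy).1
              have hs2 : s ^ 2 ≤ s ^ 1 := pow_le_pow_of_le_one hs.le hs1' one_le_two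
              gcongr
          _ = _ := by ring
      · simp [(hηz y hy).1]
    have e2 : |∫ y, (f (s • y) - Q (s • y)) * eLap η y| ≤ s ^ (N + 1) * ∫ y, b * |eLap η y| := by
      rw [← integral_const_mul, ← Real.norm_eq_abs]
      refine norm_integral_le_of_norm_le (i1.const_mul _) (Eventually.of_forall fun y => ?_)
      rcases le_or_gt ‖y‖ R with hy | hy
      · rw [Real.norm_eq_abs, abs_mul, ← mul_assoc]
        exact mul_le_mul_of_nonneg_right (hsy y hy).2 (abs_nonneg _)
      · simp [(hηz y hy).2]
    have e3 : s ^ N * |∫ y, Q y * eLap η y| ≤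
        s ^ N * (s * ((∫ y, b * |eLap η y|) + ∫ y, t * (|Q y| + b) * |η y|)) := by
      rw [← abs_of_nonneg (by positivity : 0 ≤ s ^ N), ← abs_mul,
        abs_of_nonneg (by positivity : 0 ≤ s ^ N), e]
      refine (abs_sub _ _).trans ((add_le_add e1 e2).trans_eq ?_)
      ring
    exact le_of_mul_le_mul_left e3 (by positivity)
  have hlim : Tendsto (fun s : ℝ => s * ((∫ y, b * |eLap η y|) + ∫ y, t * (|Q y| + b) * |η y|))
      (𝓝[>] 0) (𝓝 0) := by
    have : Continuous fun s : ℝ =>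
      s * ((∫ y, b * |eLap η y|) + ∫ y, t * (|Q y| + b) * |η y|) := by fun_prop
    simpa using (this.tendsto 0).mono_left nhdsWithin_le_nhds
  exact abs_nonpos_iff.1 (ge_of_tendsto hlim key)

end Harmonic

section Normalized

variable {κ : Type*} [Fintype κ] [DecidableEq κ]

omit [DecidableEq κ] in
lemma exists_contDiff_eqOn_ball {ψ : EuclideanSpace ℝ κ → ℝ}
    (hψ : ContDiffOn ℝ 2 ψ (Metric.ball 0 3)) : ∃ f : EuclideanSpace ℝ κ → ℝ, ContDiff ℝ 2 f ∧
      ∀ x, ‖x‖ ≤ 5 / 2 → f x = ψ x := by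
  let χ : ContDiffBump (0 : EuclideanSpace ℝ κ) := ⟨5 / 2, 11 / 4, by norm_num, by norm_num⟩
  refine ⟨fun x => χ x * ψ x, contDiff_iff_contDiffAt.2 fun x => ?_, fun x hx => ?_⟩
  · rcases lt_or_ge ‖x‖ 3 with hx | hx
    · exact χ.contDiff.contDiffAt.mul
        (hψ.contDiffAt (Metric.isOpen_ball.mem_nhds (mem_ball_zero_iff.2 hx)))
    · refine (contDiffAt_const (c := (0 : ℝ))).congr_of_eventuallyEq ?_
      filter_upwards [(isOpen_lt continuous_const continuous_norm).mem_nhds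
        (show (11 / 4 : ℝ) < ‖x‖ by linarith)] with z (hz : 11 / 4 < ‖z‖)
      rw [χ.zero_of_le_dist (by rw [dist_zero_right]; exact hz.le), zero_mul]
  · simp only
    rw [χ.one_of_mem_closedBall (mem_closedBall_zero_iff.2 hx), one_mul]

lemma exists_leading_part_of_ball (hκ : 2 ≤ Fintype.card κ) {t : ℝ} (ht : 0 ≤ t) :
    ∃ C : ℝ, 1 ≤ C ∧ ∀ (N : ℕ) (M : ℝ) (ψ : EuclideanSpace ℝ κ → ℝ),
      ContDiffOn ℝ 2 ψ (Metric.ball 0 3) → IntegrableOn (fun x => ψ x ^ 2) (Metric.ball 0 3) →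
      (∀ x, ‖x‖ < 3 → |eLap ψ x| ≤ t * |ψ x|) → (∀ᶠ x in 𝓝 0, |ψ x| ≤ M * ‖x‖ ^ N) →
      ∃ Q ∈ homogPolyFun κ N, (∀ x, eLap Q x = 0) ∧ ∀ x, ‖x‖ ≤ 1 / 2 →
        |ψ x - Q x| ≤ C ^ (N + 1) * 4 ^ (N + 1).choose 2 * ‖x‖ ^ (N + 1) *
          √(∫ x in Metric.ball 0 3, ψ x ^ 2) := by
  obtain ⟨K₁, hK₁, h₁⟩ := exists_leading_part_of_abs_eLap_le hκ ht
  obtain ⟨K₂, hK₂, h₂⟩ := exists_sup_le_sqrt_setIntegral_sq hκ ht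
  refine ⟨max 1 K₂ * K₁, one_le_mul_of_one_le_of_one_le (le_max_left _ _) hK₁,
    fun N M ψ hψ hint hψt hψM => ?_⟩
  obtain ⟨f, hf, hfψ⟩ := exists_contDiff_eqOn_ball hψ
  have hball : ∀ r : ℝ, 0 < r → ∀ᶠ x in 𝓝 (0 : EuclideanSpace ℝ κ), ‖x‖ < r := fun r hr => by
    filter_upwards [Metric.ball_mem_nhds (0 : EuclideanSpace ℝ κ) hr] with x hx
      using mem_ball_zero_iff.1 hx
  have hft : ∀ x, ‖x‖ < 5 / 2 → |eLap f x| ≤ t * |f x| := by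
    intro x hx
    have he : f =ᶠ[𝓝 x] ψ := by
      filter_upwards [Metric.isOpen_ball.mem_nhds (mem_ball_zero_iff.2 hx)] with z hz
        using hfψ z (mem_ball_zero_iff.1 hz).le
    rw [he.eLap_eq, hfψ x hx.le]
    exact hψt x (by linarith)
  set s := √(∫ x in Metric.ball 0 3, ψ x ^ 2)
  have hs : √(∫ x in Metric.closedBall 0 (5 / 2), f x ^ 2) ≤ s := by
    refine Real.sqrt_le_sqrt ?_
    rw [setIntegral_congr_fun (g := fun x => ψ x ^ 2) measurableSet_closedBall
      fun x hx => by simp only [hfψ x (mem_closedBall_zero_iff.1 hx)]]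
    exact setIntegral_mono_set hint (Eventually.of_forall fun x => sq_nonneg _)
      (Metric.closedBall_subset_ball (by norm_num)).eventuallyLE
  have hfA : ∀ x, ‖x‖ ≤ 2 → |f x| ≤ K₂ * s := fun x hx =>
    (h₂ f hf hft x hx).trans (mul_le_mul_of_nonneg_left hs hK₂)
  obtain ⟨Q, hQ, hQx⟩ := h₁ N (K₂ * s) M f hf (by positivity) hfA
    (fun x hx => hft x (by linarith)) (by
      filter_upwards [hψM, hball 2 two_pos] with x hx hx2
      rwa [hfψ x (by linarith)])
  refine ⟨Q, hQ, eLap_eq_zero_of_isLeading ht hf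
    ((hball 2 two_pos).mono fun x hx => hft x (by linarith)) hQ
    ((hball 2 two_pos).mono fun x hx => hQx x hx.le), fun x hx => ?_⟩
  rw [← hfψ x (by linarith)]
  refine (hQx x (by linarith)).trans ?_
  have hK : K₂ * K₁ ^ (N + 1) ≤ (max 1 K₂ * K₁) ^ (N + 1) := by
    rw [mul_pow]
    gcongr
    exact (le_max_right _ _).trans (le_self_pow₀ (le_max_left _ _) N.succ_ne_zero)
  calc _ = K₂ * K₁ ^ (N + 1) * (4 ^ (N + 1).choose 2 * ‖x‖ ^ (N + 1) * s) := by ring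
    _ ≤ (max 1 K₂ * K₁) ^ (N + 1) * (4 ^ (N + 1).choose 2 * ‖x‖ ^ (N + 1) * s) := by gcongr
    _ = _ := by ring

end Normalized

section Decomposition

lemma lap_eq_eLap {d : ℕ} (f : EuclideanSpace ℝ (Fin d) → ℝ) : lap f = eLap f := rfl

variable {d : ℕ} {W : EuclideanSpace ℝ (Fin d) → ℝ} {x₀ : EuclideanSpace ℝ (Fin d)}

lemma abs_eLap_le_of_mem_solSet {Ω : Set (EuclideanSpace ℝ (Fin d))} {φ : EuclideanSpace ℝ (Fin d) → ℝ}
    {Winf : ℝ} (hΩ : IsOpen Ω) (hW : ∀ x ∈ Ω, |W x| ≤ Winf) (hφ : φ ∈ solSet Ω W) :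
    ∀ x ∈ Ω, |eLap φ x| ≤ Winf * |φ x| := by
  obtain ⟨hc, -, hae⟩ := hφ
  have hat : ∀ x ∈ Ω, ContDiffAt ℝ 2 φ x := fun x hx => hc.contDiffAt (hΩ.mem_nhds hx)
  have hcont : ContinuousOn (fun x => |eLap φ x| - Winf * |φ x|) Ω := fun x hx =>
    ((continuousAt_eLap (hat x hx)).abs.sub
      ((hat x hx).continuousAt.abs.const_mul Winf)).continuousWithinAt
  have hopen : IsOpen (Ω ∩ (fun x => |eLap φ x| - Winf * |φ x|) ⁻¹' Set.Ioi 0) :=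
    hcont.isOpen_inter_preimage hΩ isOpen_Ioi
  have hnull : volume (Ω ∩ (fun x => |eLap φ x| - Winf * |φ x|) ⁻¹' Set.Ioi 0) = 0 := by
    refine measure_mono_null (t := {x | ¬(x ∈ Ω → lap φ x = W x * φ x)}) (fun x hx h => ?_)
      (ae_iff.1 hae)
    obtain ⟨hxΩ, hx⟩ := hx
    have h' := h hxΩ
    rw [lap_eq_eLap] at h'
    rw [Set.mem_preimage, Set.mem_Ioi, h', abs_mul, ← sub_mul] at hx
    exact absurd hx (not_lt.2 (mul_nonpos_of_nonpos_of_nonneg (sub_nonpos.2 (hW x hxΩ)) (abs_nonneg _)))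
  intro x hx
  by_contra hlt
  have : x ∈ Ω ∩ (fun x => |eLap φ x| - Winf * |φ x|) ⁻¹' Set.Ioi 0 :=
    ⟨hx, sub_pos.2 (not_le.1 hlt)⟩
  rw [hopen.measure_eq_zero_iff volume |>.1 hnull] at this
  exact this

lemma eventually_nhds_abs_le_of_punctured [Nontrivial (EuclideanSpace ℝ (Fin d))]
    {φ : EuclideanSpace ℝ (Fin d) → ℝ} (hφ : ContinuousAt φ x₀) {M : ℝ} {k : ℕ}
    (h : ∀ᶠ x in 𝓝[≠] x₀, |φ x| ≤ M * ‖x - x₀‖ ^ k) : ∀ᶠ x in 𝓝 x₀, |φ x| ≤ M * ‖x - x₀‖ ^ k := by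
  have hM : ContinuousAt (fun x => M * ‖x - x₀‖ ^ k) x₀ := by fun_prop
  have := Module.punctured_nhds_neBot ℝ (EuclideanSpace ℝ (Fin d)) x₀
  have h0 : |φ x₀| ≤ M * ‖x₀ - x₀‖ ^ k :=
    le_of_tendsto_of_tendsto (hφ.abs.tendsto.mono_left nhdsWithin_le_nhds)
      (hM.tendsto.mono_left nhdsWithin_le_nhds) h
  rw [← nhdsNE_sup_pure]
  exact eventually_sup.2 ⟨h, h0⟩

/-- `P` is the leading homogeneous polynomial of degree `N` of `φ` at `x₀`. -/
def IsLeadingPoly (φ : EuclideanSpace ℝ (Fin d) → ℝ) (x₀ : EuclideanSpace ℝ (Fin d)) (N : ℕ)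
    (P : MvPolynomial (Fin d) ℝ) : Prop :=
  P.IsHomogeneous N ∧ ∃ M : ℝ, ∀ᶠ x in 𝓝 x₀,
    |φ x - MvPolynomial.eval (fun i => x i - x₀ i) P| ≤ M * ‖x - x₀‖ ^ (N + 1)

variable {φ φ₁ φ₂ : EuclideanSpace ℝ (Fin d) → ℝ} {N : ℕ} {P P₁ P₂ : MvPolynomial (Fin d) ℝ}

lemma IsLeadingPoly.add (h₁ : IsLeadingPoly φ₁ x₀ N P₁) (h₂ : IsLeadingPoly φ₂ x₀ N P₂) :
    IsLeadingPoly (φ₁ + φ₂) x₀ N (P₁ + P₂) := by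
  obtain ⟨hP₁, M₁, h₁⟩ := h₁
  obtain ⟨hP₂, M₂, h₂⟩ := h₂
  refine ⟨hP₁.add hP₂, M₁ + M₂, ?_⟩
  filter_upwards [h₁, h₂] with x e₁ e₂
  rw [Pi.add_apply, map_add, add_sub_add_comm, add_mul]
  exact (abs_add_le _ _).trans (add_le_add e₁ e₂)

lemma IsLeadingPoly.smul (h : IsLeadingPoly φ x₀ N P) (c : ℝ) :
    IsLeadingPoly (c • φ) x₀ N (c • P) := by
  obtain ⟨hP, M, h⟩ := h
  refine ⟨(MvPolynomial.homogeneousSubmodule _ ℝ N).smul_mem c hP, |c| * M, ?_⟩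
  filter_upwards [h] with x e
  rw [Pi.smul_apply, MvPolynomial.smul_eval, smul_eq_mul, ← mul_sub, abs_mul, mul_assoc]
  exact mul_le_mul_of_nonneg_left e (abs_nonneg c)

lemma IsLeadingPoly.unique (h₁ : IsLeadingPoly φ x₀ N P₁) (h₂ : IsLeadingPoly φ x₀ N P₂) :
    P₁ = P₂ := by
  obtain ⟨hP, M, h⟩ := h₁.add (h₂.smul (-1))
  have hz : φ + (-1 : ℝ) • φ = 0 := by simp
  simp only [hz] at h
  set P := P₁ + (-1 : ℝ) • P₂ with hPdef
  have hmem : (fun x : EuclideanSpace ℝ (Fin d) => MvPolynomial.eval (fun i => x i) P) ∈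
      homogPolyFun (Fin d) N := ⟨P, hP, fun _ => rfl⟩
  have ht : Tendsto (fun y : EuclideanSpace ℝ (Fin d) => x₀ + y) (𝓝 0) (𝓝 x₀) := by
    have : Continuous fun y : EuclideanSpace ℝ (Fin d) => x₀ + y := by fun_prop
    simpa using this.tendsto 0
  have hev := homogPolyFun_eq_zero_of_le hmem (M := M) ((ht.eventually h).mono fun y hy => by
    simpa using hy)
  have h0 : P = 0 := MvPolynomial.funext fun v => by simpa using hev (WithLp.toLp 2 v)
  rw [hPdef, neg_one_smul, ← sub_eq_add_neg, sub_eq_zero] at h0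
  exact h0

open Classical in
/-- The leading homogeneous polynomial of degree `N` of `φ` at `x₀`, and `0` if there is none. -/
noncomputable def leadingPoly (x₀ : EuclideanSpace ℝ (Fin d)) (N : ℕ)
    (φ : EuclideanSpace ℝ (Fin d) → ℝ) : MvPolynomial (Fin d) ℝ :=
  if h : ∃ P, IsLeadingPoly φ x₀ N P then h.choose else 0

lemma IsLeadingPoly.leadingPoly_eq (h : IsLeadingPoly φ x₀ N P) : leadingPoly x₀ N φ = P := by
  have h' : ∃ P, IsLeadingPoly φ x₀ N P := ⟨P, h⟩
  rw [leadingPoly, dif_pos h']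
  exact h'.choose_spec.unique h

lemma mem_harmHomog_of_eLap_eq_zero (hP : P.IsHomogeneous N)
    (h : ∀ x : EuclideanSpace ℝ (Fin d),
      eLap (fun x : EuclideanSpace ℝ (Fin d) => MvPolynomial.eval (fun i => x i) P) x = 0) :
    P ∈ harmHomog d N := by
  refine ⟨hP, LinearMap.mem_ker.2 (MvPolynomial.funext fun v => ?_)⟩
  have := h (WithLp.toLp 2 v)
  rw [MvPolynomial.eLap_eval] at this
  simpa [LinearMap.sum_apply] using this

lemma exists_isLeadingPoly_bound (hd : 2 ≤ d) {t : ℝ} (ht : 0 ≤ t) : ∃ C : ℝ, 1 ≤ C ∧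
    ∀ (x₀ : EuclideanSpace ℝ (Fin d)) (r Winf : ℝ), 0 < r → r ^ 2 * Winf = t →
      ∀ W : EuclideanSpace ℝ (Fin d) → ℝ, (∀ x ∈ Metric.ball x₀ (3 * r), |W x| ≤ Winf) →
      ∀ (N : ℕ), ∀ φ ∈ solSetN (Metric.ball x₀ (3 * r)) W x₀ N,
        ∃ P ∈ harmHomog d N, ∀ x, ‖x - x₀‖ ≤ r / 2 →
          |φ x - MvPolynomial.eval (fun i => x i - x₀ i) P| ≤
            r ^ (-(d : ℝ) / 2) * (r⁻¹ * C) ^ (N + 1) * 4 ^ (N + 1).choose 2 *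
              ‖x - x₀‖ ^ (N + 1) * √(∫ y in Metric.ball x₀ (3 * r), φ y ^ 2) := by
  obtain ⟨C, hC, h⟩ := exists_leading_part_of_ball (κ := Fin d) (by simpa using hd) ht
  refine ⟨C, hC, fun x₀ r Winf hr hrW W hW N φ hφ => ?_⟩
  have : Nontrivial (EuclideanSpace ℝ (Fin d)) :=
    Module.nontrivial_of_finrank_pos (R := ℝ) (by rw [finrank_euclideanSpace_fin]; omega)
  obtain ⟨hsol, M, hM⟩ := hφ
  have hL := abs_eLap_le_of_mem_solSet Metric.isOpen_ball hW hsol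
  obtain ⟨hc, hint, -⟩ := hsol
  have hc0 : ContDiffAt ℝ 2 φ x₀ :=
    hc.contDiffAt (Metric.isOpen_ball.mem_nhds (Metric.mem_ball_self (by positivity)))
  have hM' := eventually_nhds_abs_le_of_punctured hc0.continuousAt hM
  have hmem : ∀ y : EuclideanSpace ℝ (Fin d), ‖y‖ < 3 → x₀ + r • y ∈ Metric.ball x₀ (3 * r) := by
    intro y hy
    rw [mem_ball_iff_norm, add_sub_cancel_left, norm_smul, Real.norm_of_nonneg hr.le, mul_comm]
    gcongr
  set g : EuclideanSpace ℝ (Fin d) → ℝ := (Metric.ball x₀ (3 * r)).indicator fun x => φ x ^ 2 with hg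
  have hgind : (Metric.ball 0 3).indicator (fun y => φ (x₀ + r • y) ^ 2) = fun y => g (x₀ + r • y) := by
    funext y
    by_cases hy : ‖y‖ < 3
    · rw [Set.indicator_of_mem (mem_ball_zero_iff.2 hy), hg, Set.indicator_of_mem (hmem y hy)]
    · rw [Set.indicator_of_notMem (by simpa using hy), hg, Set.indicator_of_notMem]
      rw [mem_ball_iff_norm, add_sub_cancel_left, norm_smul, Real.norm_of_nonneg hr.le, mul_comm,
        not_lt]
      exact mul_le_mul_of_nonneg_right (not_lt.1 hy) hr.le
  have ig : Integrable g := (integrable_indicator_iff measurableSet_ball).2 hint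
  have hψint : IntegrableOn (fun y => φ (x₀ + r • y) ^ 2) (Metric.ball 0 3) := by
    rw [← integrable_indicator_iff measurableSet_ball, hgind]
    exact (ig.comp_add_left x₀).comp_smul hr.ne'
  have hψ2 : ∫ y in Metric.ball 0 3, φ (x₀ + r • y) ^ 2 =
      (r ^ d)⁻¹ * ∫ y in Metric.ball x₀ (3 * r), φ y ^ 2 := by
    rw [← integral_indicator measurableSet_ball, hgind,
      Measure.integral_comp_smul volume (fun y => g (x₀ + y)) r, integral_add_left_eq_self,
      integral_indicator measurableSet_ball, finrank_euclideanSpace_fin, smul_eq_mul,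
      abs_of_nonneg (by positivity)]
  have haff : Continuous fun y : EuclideanSpace ℝ (Fin d) => x₀ + r • y := by fun_prop
  obtain ⟨Q, ⟨P, hP, hPQ⟩, hharm, hbound⟩ := h N (M * r ^ N) (fun y => φ (x₀ + r • y))
    (hc.comp (by fun_prop) fun y hy => hmem y (mem_ball_zero_iff.1 hy)) hψint
    (fun y hy => by
      rw [eLap_comp_homothety x₀ r (hc.contDiffAt (Metric.isOpen_ball.mem_nhds (hmem y hy))),
        abs_mul, abs_of_nonneg (sq_nonneg r), ← hrW, mul_assoc]
      exact mul_le_mul_of_nonneg_left (hL _ (hmem y hy)) (sq_nonneg r))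
    (by
      have ht0 : Tendsto (fun y : EuclideanSpace ℝ (Fin d) => x₀ + r • y) (𝓝 0) (𝓝 x₀) := by
        simpa using haff.tendsto 0
      filter_upwards [ht0.eventually hM'] with y hy
      rwa [add_sub_cancel_left, norm_smul, Real.norm_of_nonneg hr.le, mul_pow, ← mul_assoc] at hy)
  have hPharm : P ∈ harmHomog d N := mem_harmHomog_of_eLap_eq_zero hP fun x => by
    rw [← funext hPQ]; exact hharm x
  refine ⟨(r⁻¹ ^ N) • P, (harmHomog d N).smul_mem _ hPharm, fun x hx => ?_⟩
  set y := r⁻¹ • (x - x₀) with hy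
  have hyn : ‖y‖ = r⁻¹ * ‖x - x₀‖ := by
    rw [hy, norm_smul, Real.norm_of_nonneg (inv_nonneg.2 hr.le)]
  have hxy : x₀ + r • y = x := by
    rw [hy, smul_smul, mul_inv_cancel₀ hr.ne', one_smul, add_sub_cancel]
  have hQP : MvPolynomial.eval (fun i => x i - x₀ i) ((r⁻¹ ^ N) • P) = Q y := by
    rw [hy, homogPolyFun_smul ⟨P, hP, hPQ⟩, hPQ, MvPolynomial.smul_eval]
    rfl
  have hb := hbound y (by
    rw [hyn, inv_mul_le_iff₀ hr]
    linarith)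
  rw [hxy, hyn, hψ2, Real.sqrt_mul (by positivity)] at hb
  have hr2 : √((r ^ d)⁻¹) = r ^ (-(d : ℝ) / 2) := by
    rw [Real.sqrt_eq_rpow, ← Real.rpow_natCast, ← Real.rpow_neg hr.le, ← Real.rpow_mul hr.le]
    ring_nf
  rw [hQP]
  refine hb.trans_eq ?_
  rw [hr2]
  ring

end Decomposition

section Kernel

variable {d : ℕ} {W : EuclideanSpace ℝ (Fin d) → ℝ} {x₀ : EuclideanSpace ℝ (Fin d)}
  {φ : EuclideanSpace ℝ (Fin d) → ℝ} {N : ℕ}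

lemma isLeadingPoly_zero_iff_of_mem_solSet (hd : 2 ≤ d) {r : ℝ} (hr : 0 < r)
    (hφ : φ ∈ solSet (Metric.ball x₀ r) W) :
    IsLeadingPoly φ x₀ N 0 ↔ φ ∈ solSetN (Metric.ball x₀ r) W x₀ (N + 1) := by
  have : Nontrivial (EuclideanSpace ℝ (Fin d)) :=
    Module.nontrivial_of_finrank_pos (R := ℝ) (by rw [finrank_euclideanSpace_fin]; omega)
  have hc : ContinuousAt φ x₀ :=
    (hφ.1.contDiffAt (Metric.isOpen_ball.mem_nhds (Metric.mem_ball_self hr))).continuousAt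
  constructor
  · rintro ⟨-, M, hM⟩
    simp only [map_zero, sub_zero] at hM
    exact ⟨hφ, M, hM.filter_mono nhdsWithin_le_nhds⟩
  · rintro ⟨-, M, hM⟩
    refine ⟨MvPolynomial.isHomogeneous_zero _ _ _, M, ?_⟩
    simpa only [map_zero, sub_zero] using eventually_nhds_abs_le_of_punctured hc hM

lemma four_pow_choose_two_le (d N : ℕ) :
    (4 : ℝ) ^ (N + 1).choose 2 ≤
      (16 / 3 : ℝ) ^ ((N + 1) * (N + 2) / 2) * ((N + 1).factorial : ℝ) ^ (d - 2) := by
  have h1 : (4 : ℝ) ^ (N + 1).choose 2 ≤ (16 / 3 : ℝ) ^ ((N + 1) * (N + 2) / 2) := by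
    have hexp : (N + 1).choose 2 ≤ (N + 1) * (N + 2) / 2 := by
      rw [Nat.choose_two_right]
      exact Nat.div_le_div_right (Nat.mul_le_mul_left _ (by omega))
    calc (4 : ℝ) ^ (N + 1).choose 2 ≤ 4 ^ ((N + 1) * (N + 2) / 2) :=
          pow_le_pow_right₀ (by norm_num) hexp
      _ ≤ _ := pow_le_pow_left₀ (by norm_num) (by norm_num) _
  refine h1.trans (le_mul_of_one_le_right (by positivity) (one_le_pow₀ ?_))
  exact_mod_cast Nat.factorial_pos (N + 1)

end Kernel

end

/-- Quantitative local decomposition of solutions on `Ω = B(x₀, 3r₀)`: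
there is `C̃ ≥ 1`, depending only on `d` and `t = r₀² Winf`, such that for every `N` there
is a linear map `Y_N : E_N(Ω) → H_N^{(d)}` with the stated quantitative bound on
`φ - (Y_N φ)(· - x₀)` on `B̄(x₀, r₀/2)`, and with kernel `E_{N+1}(Ω)`. -/
theorem quantitative_local_decomposition (d : ℕ) (hd : 2 ≤ d) (t : ℝ) (ht : 0 ≤ t) :
    ∃ C : ℝ, 1 ≤ C ∧
      ∀ (x₀ : EuclideanSpace ℝ (Fin d)) (r₀ Winf : ℝ), 0 < r₀ → 0 ≤ Winf →
        r₀ ^ 2 * Winf = t →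
      ∀ W : EuclideanSpace ℝ (Fin d) → ℝ, Measurable W →
        (∀ x ∈ Metric.ball x₀ (3 * r₀), |W x| ≤ Winf) →
      ∀ N : ℕ,
        ∃ Y : (EuclideanSpace ℝ (Fin d) → ℝ) → MvPolynomial (Fin d) ℝ,
          (∀ φ ∈ solSetN (Metric.ball x₀ (3 * r₀)) W x₀ N, Y φ ∈ harmHomog d N) ∧
          (∀ φ₁ ∈ solSetN (Metric.ball x₀ (3 * r₀)) W x₀ N,
            ∀ φ₂ ∈ solSetN (Metric.ball x₀ (3 * r₀)) W x₀ N,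
              Y (φ₁ + φ₂) = Y φ₁ + Y φ₂) ∧
          (∀ c : ℝ, ∀ φ ∈ solSetN (Metric.ball x₀ (3 * r₀)) W x₀ N,
            Y (c • φ) = c • Y φ) ∧
          (∀ φ ∈ solSetN (Metric.ball x₀ (3 * r₀)) W x₀ N,
            ∀ x : EuclideanSpace ℝ (Fin d), ‖x - x₀‖ ≤ r₀ / 2 →
              |φ x - MvPolynomial.eval (fun i => x i - x₀ i) (Y φ)| ≤
                r₀ ^ (-(d : ℝ) / 2) * (r₀⁻¹ * C) ^ (N + 1) *
                  (16 / 3 : ℝ) ^ ((N + 1) * (N + 2) / 2) *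
                  ((N + 1).factorial : ℝ) ^ (d - 2) * ‖x - x₀‖ ^ (N + 1) *
                  Real.sqrt (∫ y in Metric.ball x₀ (3 * r₀), φ y ^ 2)) ∧
          (∀ φ ∈ solSetN (Metric.ball x₀ (3 * r₀)) W x₀ N,
            (Y φ = 0 ↔ φ ∈ solSetN (Metric.ball x₀ (3 * r₀)) W x₀ (N + 1))) := by
  obtain ⟨C, hC, h⟩ := exists_isLeadingPoly_bound hd ht
  refine ⟨C, hC, fun x₀ r₀ Winf hr _ hrW W _ hW N => ?_⟩
  have key : ∀ φ ∈ solSetN (Metric.ball x₀ (3 * r₀)) W x₀ N,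
      IsLeadingPoly φ x₀ N (leadingPoly x₀ N φ) ∧ leadingPoly x₀ N φ ∈ harmHomog d N ∧
      ∀ x, ‖x - x₀‖ ≤ r₀ / 2 →
        |φ x - MvPolynomial.eval (fun i => x i - x₀ i) (leadingPoly x₀ N φ)| ≤
          r₀ ^ (-(d : ℝ) / 2) * (r₀⁻¹ * C) ^ (N + 1) * 4 ^ (N + 1).choose 2 *
            ‖x - x₀‖ ^ (N + 1) * √(∫ y in Metric.ball x₀ (3 * r₀), φ y ^ 2) := by
    intro φ hφ
    obtain ⟨P, hP, hb⟩ := h x₀ r₀ Winf hr hrW W hW N φ hφ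
    have hlead : IsLeadingPoly φ x₀ N P := by
      refine ⟨hP.1, r₀ ^ (-(d : ℝ) / 2) * (r₀⁻¹ * C) ^ (N + 1) * 4 ^ (N + 1).choose 2 *
        √(∫ y in Metric.ball x₀ (3 * r₀), φ y ^ 2), ?_⟩
      filter_upwards [Metric.ball_mem_nhds x₀ (half_pos hr)] with x hx
      exact (hb x (mem_ball_iff_norm.1 hx).le).trans_eq (mul_right_comm _ _ _)
    rw [hlead.leadingPoly_eq]
    exact ⟨hlead, hP, hb⟩
  refine ⟨leadingPoly x₀ N, fun φ hφ => (key φ hφ).2.1,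
    fun φ₁ h₁ φ₂ h₂ => ((key φ₁ h₁).1.add (key φ₂ h₂).1).leadingPoly_eq,
    fun c φ hφ => ((key φ hφ).1.smul c).leadingPoly_eq, fun φ hφ x hx => ?_, fun φ hφ => ?_⟩
  · refine ((key φ hφ).2.2 x hx).trans ?_
    rw [mul_assoc _ (_ ^ ((N + 1) * (N + 2) / 2))]
    gcongr
    exact four_pow_choose_two_le d N
  · rw [← isLeadingPoly_zero_iff_of_mem_solSet hd (by positivity) hφ.1]
    exact ⟨fun h0 => h0 ▸ (key φ hφ).1, IsLeadingPoly.leadingPoly_eq⟩
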